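/- arXiv:math/0611358 — 2 statements merged into one kernel-verified Lean document; each statement's English description precedes it below -/
import Mathlib

section
/- The left weak Gorenstein global dimension of R is at most the supremum of the left Gorenstein global dimension of R and the right Gorenstein global dimension of R. -/
/-! Definitions for Gorenstein homological algebra over an arbitrary
associative ring `R` (left modules; right modules are `Rᵐᵒᵖ`-modules). -/

universe u

section Defs

variable (R : Type u) [Ring R]

/-- `0 → A → B → C → 0` is a short exact sequence. -/
def IsSES {A B C : Type u} [AddCommGroup A] [Module R A] [AddCommGroup B] [Module R B]
    [AddCommGroup C] [Module R C] (f : A →ₗ[R] B) (g : B →ₗ[R] C) : Prop :=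
  Function.Injective f ∧ Function.Exact f g ∧ Function.Surjective g

/-- `M` is Gorenstein projective: it is the kernel of a map in a doubly infinite exact
complex of projective modules which stays exact under `Hom_R(-, Q)` for every projective `Q`. -/
def GorensteinProjective (M : Type u) [AddCommGroup M] [Module R M] : Prop :=
  ∃ (P : ℤ → Type u) (_ : ∀ i, AddCommGroup (P i)) (_ : ∀ i, Module R (P i))
    (d : ∀ i, P i →ₗ[R] P (i + 1)),
      (∀ i, Module.Projective R (P i)) ∧
      (∀ i, Function.Exact (d i) (d (i + 1))) ∧
      Nonempty (M ≃ₗ[R] LinearMap.ker (d 0)) ∧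
      (∀ (Q : Type u) (_ : AddCommGroup Q) (_ : Module R Q), Module.Projective R Q →
        ∀ i, Function.Exact (fun g : P (i + 1 + 1) →ₗ[R] Q => g.comp (d (i + 1)))
          (fun g : P (i + 1) →ₗ[R] Q => g.comp (d i)))

/-- `M` is strongly Gorenstein projective: there is a complete projective resolution
with a single projective module `P` and a single map `f`. -/
def StronglyGorensteinProjective (M : Type u) [AddCommGroup M] [Module R M] : Prop :=
  ∃ (P : Type u) (_ : AddCommGroup P) (_ : Module R P) (f : P →ₗ[R] P),
    Module.Projective R P ∧
    Function.Exact f f ∧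
    Nonempty (M ≃ₗ[R] LinearMap.ker f) ∧
    (∀ (Q : Type u) (_ : AddCommGroup Q) (_ : Module R Q), Module.Projective R Q →
      Function.Exact (fun g : P →ₗ[R] Q => g.comp f) (fun g : P →ₗ[R] Q => g.comp f))

/-- `M` is Gorenstein injective (dual to Gorenstein projective). -/
def GorensteinInjective (M : Type u) [AddCommGroup M] [Module R M] : Prop :=
  ∃ (I : ℤ → Type u) (_ : ∀ i, AddCommGroup (I i)) (_ : ∀ i, Module R (I i))
    (d : ∀ i, I i →ₗ[R] I (i + 1)),
      (∀ i, Module.Injective R (I i)) ∧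
      (∀ i, Function.Exact (d i) (d (i + 1))) ∧
      Nonempty (M ≃ₗ[R] LinearMap.ker (d 0)) ∧
      (∀ (E : Type u) (_ : AddCommGroup E) (_ : Module R E), Module.Injective R E →
        ∀ i, Function.Exact (fun g : E →ₗ[R] I i => (d i).comp g)
          (fun g : E →ₗ[R] I (i + 1) => (d (i + 1)).comp g))

/-- `M` is strongly Gorenstein injective. -/
def StronglyGorensteinInjective (M : Type u) [AddCommGroup M] [Module R M] : Prop :=
  ∃ (I : Type u) (_ : AddCommGroup I) (_ : Module R I) (f : I →ₗ[R] I),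
    Module.Injective R I ∧
    Function.Exact f f ∧
    Nonempty (M ≃ₗ[R] LinearMap.ker f) ∧
    (∀ (E : Type u) (_ : AddCommGroup E) (_ : Module R E), Module.Injective R E →
      Function.Exact (fun g : E →ₗ[R] I => f.comp g) (fun g : E →ₗ[R] I => f.comp g))

/-- `M` admits a resolution `0 → G_n → ⋯ → G_0 → M → 0` by modules satisfying `𝒢`
(formalized as an `ℕ`-indexed resolution vanishing in degrees `> n`). -/
def HasLeftResolutionLE
    (𝒢 : ∀ (N : Type u) [AddCommGroup N] [Module R N], Prop)
    (M : Type u) [AddCommGroup M] [Module R M] (n : ℕ) : Prop :=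
  ∃ (G : ℕ → Type u) (_ : ∀ i, AddCommGroup (G i)) (_ : ∀ i, Module R (G i))
    (d : ∀ i, G (i + 1) →ₗ[R] G i) (π : G 0 →ₗ[R] M),
      (∀ i, 𝒢 (G i)) ∧
      (∀ i, n < i → Subsingleton (G i)) ∧
      Function.Surjective π ∧ Function.Exact (d 0) π ∧
      (∀ i, Function.Exact (d (i + 1)) (d i))

/-- `M` admits a coresolution `0 → M → G^0 → ⋯ → G^n → 0` by modules satisfying `𝒢`. -/
def HasRightResolutionLE
    (𝒢 : ∀ (N : Type u) [AddCommGroup N] [Module R N], Prop)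
    (M : Type u) [AddCommGroup M] [Module R M] (n : ℕ) : Prop :=
  ∃ (G : ℕ → Type u) (_ : ∀ i, AddCommGroup (G i)) (_ : ∀ i, Module R (G i))
    (d : ∀ i, G i →ₗ[R] G (i + 1)) (ι : M →ₗ[R] G 0),
      (∀ i, 𝒢 (G i)) ∧
      (∀ i, n < i → Subsingleton (G i)) ∧
      Function.Injective ι ∧ Function.Exact ι (d 0) ∧
      (∀ i, Function.Exact (d i) (d (i + 1)))

variable (M : Type u) [AddCommGroup M] [Module R M]

/-- Projective dimension, valued in `ℕ∞`. -/
noncomputable def pDim : ℕ∞ :=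
  sInf ((↑) '' {n : ℕ | HasLeftResolutionLE R (fun N _ _ => Module.Projective R N) M n})

/-- Injective dimension, valued in `ℕ∞`. -/
noncomputable def iDim : ℕ∞ :=
  sInf ((↑) '' {n : ℕ | HasRightResolutionLE R (fun N _ _ => Module.Injective R N) M n})

/-- Gorenstein projective dimension, valued in `ℕ∞`. -/
noncomputable def gpDim : ℕ∞ :=
  sInf ((↑) '' {n : ℕ | HasLeftResolutionLE R (fun N _ _ => GorensteinProjective R N) M n})

/-- Gorenstein injective dimension, valued in `ℕ∞`. -/
noncomputable def giDim : ℕ∞ :=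
  sInf ((↑) '' {n : ℕ | HasRightResolutionLE R (fun N _ _ => GorensteinInjective R N) M n})

/-- The left global dimension of `R`. -/
noncomputable def gldim : ℕ∞ :=
  sSup {d : ℕ∞ | ∃ (M : Type u) (_ : AddCommGroup M) (_ : Module R M), d = pDim R M}

/-- The left finitistic projective dimension of `R`. -/
noncomputable def FPD : ℕ∞ :=
  sSup {d : ℕ∞ | ∃ (M : Type u) (_ : AddCommGroup M) (_ : Module R M),
    pDim R M ≠ ⊤ ∧ d = pDim R M}

/-- The left Gorenstein global dimension of `R`: `sup { Gpd_R(M) }`. -/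
noncomputable def GPgldim : ℕ∞ :=
  sSup {d : ℕ∞ | ∃ (M : Type u) (_ : AddCommGroup M) (_ : Module R M), d = gpDim R M}

/-- `sup { Gid_R(M) }` over all left `R`-modules `M`. -/
noncomputable def GIgldim : ℕ∞ :=
  sSup {d : ℕ∞ | ∃ (M : Type u) (_ : AddCommGroup M) (_ : Module R M), d = giDim R M}

end Defs
section Tensor

open TensorProduct

variable (R : Type u) [Ring R]

/-- The defining relations of the tensor product `N ⊗_R M` of a right `R`-module `N`
and a left `R`-module `M`, inside the tensor product of abelian groups `N ⊗[ℤ] M`. -/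
noncomputable def tensorRel (N : Type u) [AddCommGroup N] [Module Rᵐᵒᵖ N]
    (M : Type u) [AddCommGroup M] [Module R M] : AddSubgroup (N ⊗[ℤ] M) :=
  AddSubgroup.closure {x | ∃ (r : R) (n : N) (m : M),
    x = (MulOpposite.op r • n) ⊗ₜ[ℤ] m - n ⊗ₜ[ℤ] (r • m)}

/-- The tensor product `N ⊗_R M` (an abelian group) of a right `R`-module `N` and a
left `R`-module `M` over the (possibly noncommutative) ring `R`. -/
abbrev bTensor (N : Type u) [AddCommGroup N] [Module Rᵐᵒᵖ N]
    (M : Type u) [AddCommGroup M] [Module R M] : Type u :=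
  (N ⊗[ℤ] M) ⧸ tensorRel R N M

/-- The map `N ⊗_R M →+ N ⊗_R M'` induced by a map `f : M →ₗ[R] M'` of left modules. -/
noncomputable def tmapRight (N : Type u) [AddCommGroup N] [Module Rᵐᵒᵖ N]
    {M M' : Type u} [AddCommGroup M] [Module R M] [AddCommGroup M'] [Module R M']
    (f : M →ₗ[R] M') : bTensor R N M →+ bTensor R N M' :=
  QuotientAddGroup.map _ _ (LinearMap.lTensor N (f.restrictScalars ℤ)).toAddMonoidHom <| by
    rw [tensorRel, AddSubgroup.closure_le]
    rintro x ⟨r, n, m, rfl⟩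
    simp only [AddSubgroup.coe_comap, Set.mem_preimage, LinearMap.toAddMonoidHom_coe,
      map_sub, LinearMap.lTensor_tmul, SetLike.mem_coe]
    refine AddSubgroup.subset_closure ⟨r, n, f m, ?_⟩
    simp [LinearMap.map_smul]

/-- The map `N ⊗_R M →+ N' ⊗_R M` induced by a map `g : N →ₗ[Rᵐᵒᵖ] N'` of right modules. -/
noncomputable def tmapLeft {N N' : Type u} [AddCommGroup N] [Module Rᵐᵒᵖ N]
    [AddCommGroup N'] [Module Rᵐᵒᵖ N']
    (M : Type u) [AddCommGroup M] [Module R M]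
    (g : N →ₗ[Rᵐᵒᵖ] N') : bTensor R N M →+ bTensor R N' M :=
  QuotientAddGroup.map _ _ (LinearMap.rTensor M (g.restrictScalars ℤ)).toAddMonoidHom <| by
    rw [tensorRel, AddSubgroup.closure_le]
    rintro x ⟨r, n, m, rfl⟩
    simp only [AddSubgroup.coe_comap, Set.mem_preimage, LinearMap.toAddMonoidHom_coe,
      map_sub, LinearMap.rTensor_tmul, SetLike.mem_coe]
    refine AddSubgroup.subset_closure ⟨r, g n, m, ?_⟩
    simp [LinearMap.map_smul]

/-- A left `R`-module `M` is flat if `- ⊗_R M` preserves injectivity of maps of right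
`R`-modules. -/
def ModFlat (M : Type u) [AddCommGroup M] [Module R M] : Prop :=
  ∀ (N N' : Type u) (_ : AddCommGroup N) (_ : Module Rᵐᵒᵖ N)
    (_ : AddCommGroup N') (_ : Module Rᵐᵒᵖ N') (g : N →ₗ[Rᵐᵒᵖ] N'),
      Function.Injective g → Function.Injective (tmapLeft R M g)

/-- `M` is Gorenstein flat: it is the kernel of a map in a doubly infinite exact complex
of flat modules which stays exact under `E ⊗_R -` for every injective right `R`-module `E`. -/
def GorensteinFlat (M : Type u) [AddCommGroup M] [Module R M] : Prop :=
  ∃ (F : ℤ → Type u) (_ : ∀ i, AddCommGroup (F i)) (_ : ∀ i, Module R (F i))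
    (d : ∀ i, F i →ₗ[R] F (i + 1)),
      (∀ i, ModFlat R (F i)) ∧
      (∀ i, Function.Exact (d i) (d (i + 1))) ∧
      Nonempty (M ≃ₗ[R] LinearMap.ker (d 0)) ∧
      (∀ (E : Type u) (_ : AddCommGroup E) (_ : Module Rᵐᵒᵖ E), Module.Injective Rᵐᵒᵖ E →
        ∀ i, Function.Exact (tmapRight R E (d i)) (tmapRight R E (d (i + 1))))

/-- Flat dimension, valued in `ℕ∞`. -/
noncomputable def fDim (M : Type u) [AddCommGroup M] [Module R M] : ℕ∞ :=
  sInf ((↑) '' {n : ℕ | HasLeftResolutionLE R (fun N _ _ => ModFlat R N) M n})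

/-- Gorenstein flat dimension, valued in `ℕ∞`. -/
noncomputable def gfDim (M : Type u) [AddCommGroup M] [Module R M] : ℕ∞ :=
  sInf ((↑) '' {n : ℕ | HasLeftResolutionLE R (fun N _ _ => GorensteinFlat R N) M n})

/-- The weak global dimension of `R`. -/
noncomputable def wgldim : ℕ∞ :=
  sSup {d : ℕ∞ | ∃ (M : Type u) (_ : AddCommGroup M) (_ : Module R M), d = fDim R M}

/-- The left weak Gorenstein global dimension of `R`: `sup { Gfd_R(M) }`. -/
noncomputable def GFgldim : ℕ∞ :=
  sSup {d : ℕ∞ | ∃ (M : Type u) (_ : AddCommGroup M) (_ : Module R M), d = gfDim R M}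

end Tensor

section Helpers

/-- Factor through a surjection. -/
lemma exists_factor_surj {S : Type*} [Ring S] {X B Q : Type*} [AddCommGroup X] [Module S X]
    [AddCommGroup B] [Module S B] [AddCommGroup Q] [Module S Q]
    (g : X →ₗ[S] B) (hg : Function.Surjective g) (h : X →ₗ[S] Q)
    (hk : ∀ x, g x = 0 → h x = 0) : ∃ e : B →ₗ[S] Q, ∀ x, e (g x) = h x := by
  refine ⟨((LinearMap.ker g).liftQ h (fun x hx => hk x hx)).comp
    (g.quotKerEquivOfSurjective hg).symm.toLinearMap, fun x => ?_⟩
  have : (g.quotKerEquivOfSurjective hg).symm (g x) = (LinearMap.ker g).mkQ x := by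
    rw [LinearEquiv.symm_apply_eq]; rfl
  rw [LinearMap.comp_apply, LinearEquiv.coe_coe, this]
  exact Submodule.liftQ_apply _ _ _

/-- Factor through an injection. -/
lemma exists_factor_inj {S : Type*} [Ring S] {X M N : Type*} [AddCommGroup X] [Module S X]
    [AddCommGroup M] [Module S M] [AddCommGroup N] [Module S N]
    (i : N →ₗ[S] M) (hi : Function.Injective i) (f : X →ₗ[S] M)
    (hf : ∀ x, ∃ y, i y = f x) : ∃ e : X →ₗ[S] N, ∀ x, i (e x) = f x := by
  refine ⟨(LinearEquiv.ofInjective i hi).symm.toLinearMap.comp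
    (f.codRestrict (LinearMap.range i) (fun x => hf x)), fun x => ?_⟩
  have := congrArg Subtype.val ((LinearEquiv.ofInjective i hi).apply_symm_apply
    (f.codRestrict (LinearMap.range i) (fun x => hf x) x))
  exact this

/-- `Ext¹(M, Q) = 0` for all projective `Q`, phrased by extending maps. -/
def ExtVan (S : Type u) [Ring S] (M : Type u) [AddCommGroup M] [Module S M] : Prop :=
  ∀ (A B Q : Type u) (_ : AddCommGroup A) (_ : Module S A) (_ : AddCommGroup B) (_ : Module S B)
    (_ : AddCommGroup Q) (_ : Module S Q) (i : A →ₗ[S] B) (p : B →ₗ[S] M) (φ : A →ₗ[S] Q),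
    Module.Projective S Q → Function.Injective i → Function.Exact i p → Function.Surjective p →
      ∃ e : B →ₗ[S] Q, ∀ a, e (i a) = φ a

lemma ExtVan.ext {S : Type u} [Ring S] {L M N : Type u} [AddCommGroup L] [Module S L]
    [AddCommGroup M] [Module S M] [AddCommGroup N] [Module S N]
    (j : L →ₗ[S] M) (q : M →ₗ[S] N) (hj : Function.Injective j) (hjq : Function.Exact j q)
    (hq : Function.Surjective q) (hL : ExtVan S L) (hN : ExtVan S N) : ExtVan S M := by
  intro A B Q _ _ _ _ _ _ i p φ hQ hi hip hp
  let B1 : Submodule S B := LinearMap.ker (q.comp p)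
  obtain ⟨p1, hp1⟩ := exists_factor_inj j hj (p.comp B1.subtype) (fun x => by
    have := x.2
    exact (hjq _).1 this)
  let i1 : A →ₗ[S] B1 := i.codRestrict B1 (fun a => by
    show q (p (i a)) = 0
    rw [hip.apply_apply_eq_zero, map_zero])
  obtain ⟨e1, he1⟩ := hL A B1 Q _ _ _ _ _ _ i1 p1 φ hQ
    (fun a b h => hi (congrArg Subtype.val h))
    (fun x => by
      constructor
      · intro h
        have h2 := hp1 x
        rw [h, map_zero] at h2
        obtain ⟨a, ha⟩ := (hip _).1 h2.symm
        exact ⟨a, Subtype.ext ha⟩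
      · rintro ⟨a, rfl⟩
        apply hj
        rw [hp1, map_zero]
        exact hip.apply_apply_eq_zero a)
    (fun l => by
      obtain ⟨b, hb⟩ := hp (j l)
      refine ⟨⟨b, ?_⟩, ?_⟩
      · show q (p b) = 0
        rw [hb, hjq.apply_apply_eq_zero]
      · apply hj
        rw [hp1]
        exact hb)
  obtain ⟨e, he⟩ := hN B1 B Q _ _ _ _ _ _ B1.subtype (q.comp p) e1 hQ
    Subtype.val_injective (fun x => by
      constructor
      · intro h; exact ⟨⟨x, h⟩, rfl⟩
      · rintro ⟨y, rfl⟩; exact y.2) (hq.comp hp)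
  exact ⟨e, fun a => by rw [← he1, ← he]; rfl⟩

/-- Finite-depth approximation of Gorenstein projectivity. -/
def GDepth (S : Type u) [Ring S] : ℕ → ∀ (M : Type u) [AddCommGroup M] [Module S M], Prop
  | 0, M, _, _ => ExtVan S M
  | k + 1, M, _, _ => ExtVan S M ∧ ∃ (P : Type u) (_ : AddCommGroup P) (_ : Module S P)
      (f : M →ₗ[S] P), Module.Projective S P ∧ Function.Injective f ∧
        GDepth S k (P ⧸ LinearMap.range f)

lemma GDepth.extVan {S : Type u} [Ring S] {k : ℕ} {M : Type u} [AddCommGroup M] [Module S M]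
    (h : GDepth S k M) : ExtVan S M := by
  cases k with
  | zero => exact h
  | succ k => exact h.1

lemma GDepth.ext {S : Type u} [Ring S] (k : ℕ) : ∀ {L M N : Type u} [AddCommGroup L] [Module S L]
    [AddCommGroup M] [Module S M] [AddCommGroup N] [Module S N]
    (j : L →ₗ[S] M) (q : M →ₗ[S] N) (_ : Function.Injective j) (_ : Function.Exact j q)
    (_ : Function.Surjective q) (_ : GDepth S k L) (_ : GDepth S k N), GDepth S k M := by
  induction k with
  | zero =>
    intro L M N _ _ _ _ _ _ j q hj hjq hq hL hN
    exact ExtVan.ext j q hj hjq hq hL hN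
  | succ k ih =>
    intro L M N _ _ _ _ _ _ j q hj hjq hq hL hN
    refine ⟨ExtVan.ext j q hj hjq hq hL.1 hN.1, ?_⟩
    obtain ⟨-, PL, _, _, a, hPL, ha, hL'⟩ := hL
    obtain ⟨hNe, PN, _, _, c, hPN, hc, hN'⟩ := hN
    obtain ⟨h, hh⟩ := hNe L M PL _ _ _ _ _ _ j q a hPL hj hjq hq
    let ι : M →ₗ[S] PL × PN := h.prod (c.comp q)
    refine ⟨PL × PN, _, _, ι, inferInstance, ?_, ?_⟩
    · rw [injective_iff_map_eq_zero]
      intro m hm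
      have h1 : h m = 0 := congrArg Prod.fst hm
      have h2 : c (q m) = 0 := congrArg Prod.snd hm
      have h3 : q m = 0 := hc (by rw [h2, map_zero])
      obtain ⟨l, rfl⟩ := (hjq m).1 h3
      rw [hh] at h1
      rw [ha (h1.trans (map_zero a).symm), map_zero]
    · have hx : LinearMap.range a ≤ (LinearMap.range ι).comap (LinearMap.inl S PL PN) := by
        rintro _ ⟨l, rfl⟩
        refine ⟨j l, ?_⟩
        ext
        · exact hh l
        · show c (q (j l)) = 0
          rw [hjq.apply_apply_eq_zero, map_zero]
      have hy : LinearMap.range ι ≤ (LinearMap.range c).comap (LinearMap.snd S PL PN) := by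
        rintro _ ⟨m, rfl⟩
        exact ⟨q m, rfl⟩
      refine ih (Submodule.mapQ _ _ _ hx) (Submodule.mapQ _ _ _ hy) ?_ ?_ ?_ hL' hN'
      · rw [injective_iff_map_eq_zero]
        intro x
        obtain ⟨x, rfl⟩ := Submodule.mkQ_surjective _ x
        intro hx0
        have hx1 : LinearMap.inl S PL PN x ∈ LinearMap.range ι :=
          (Submodule.Quotient.mk_eq_zero _).1 hx0
        obtain ⟨m, hm⟩ := hx1
        have h1 : h m = x := congrArg Prod.fst hm
        have h2 : c (q m) = 0 := congrArg Prod.snd hm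
        have h3 : q m = 0 := hc (by rw [h2, map_zero])
        obtain ⟨l, rfl⟩ := (hjq m).1 h3
        rw [hh] at h1
        exact (Submodule.Quotient.mk_eq_zero _).2 ⟨l, h1⟩
      · intro y
        obtain ⟨y, rfl⟩ := Submodule.mkQ_surjective _ y
        constructor
        · intro hy0
          have hy1 : y.2 ∈ LinearMap.range c := (Submodule.Quotient.mk_eq_zero _).1 hy0
          obtain ⟨n, hn⟩ := hy1
          obtain ⟨m, rfl⟩ := hq n
          refine ⟨Submodule.Quotient.mk (y.1 - h m), ?_⟩
          refine (Submodule.Quotient.eq _).2 ⟨-m, ?_⟩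
          ext
          · simp [ι]
          · simp [ι, hn]
        · rintro ⟨x, hx⟩
          obtain ⟨x, rfl⟩ := Submodule.mkQ_surjective _ x
          rw [← hx]
          simp
      · intro z
        obtain ⟨z, rfl⟩ := Submodule.mkQ_surjective _ z
        exact ⟨Submodule.Quotient.mk (0, z), rfl⟩

lemma gdepth_of_complex {S : Type u} [Ring S] (P : ℤ → Type u) [∀ i, AddCommGroup (P i)]
    [∀ i, Module S (P i)] (d : ∀ i, P i →ₗ[S] P (i + 1))
    (hP : ∀ i, Module.Projective S (P i)) (hd : ∀ i, Function.Exact (d i) (d (i + 1)))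
    (hQ : ∀ (Q : Type u) (_ : AddCommGroup Q) (_ : Module S Q), Module.Projective S Q →
        ∀ i, Function.Exact (fun g : P (i + 1 + 1) →ₗ[S] Q => g.comp (d (i + 1)))
          (fun g : P (i + 1) →ₗ[S] Q => g.comp (d i))) (k : ℕ) :
    ∀ (i : ℤ) (M : Type u) [AddCommGroup M] [Module S M] (f : M →ₗ[S] P i),
      Function.Injective f → Function.Exact f (d i) → GDepth S k M := by
  have key : ∀ (i : ℤ) (M : Type u) [AddCommGroup M] [Module S M] (f : M →ₗ[S] P i),
      Function.Injective f → Function.Exact f (d i) → ExtVan S M := by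
    intro i M _ _ f hf hfd
    obtain ⟨l, rfl⟩ : ∃ l : ℤ, i = l + 1 + 1 + 1 := ⟨i - 3, by ring⟩
    intro A B Q _ _ _ _ _ _ ι p φ hQp hι hιp hp
    obtain ⟨r, hr⟩ := exists_factor_inj f hf (d (l + 1 + 1)) (fun x =>
      (hfd _).1 ((hd _).apply_apply_eq_zero x))
    obtain ⟨s, hs⟩ := Module.projective_lifting_property p r hp
    have hs' : ∀ x, p (s x) = r x := fun x => by rw [← hs]; rfl
    obtain ⟨t, ht⟩ := exists_factor_inj ι hι (s.comp (d (l + 1))) (fun x => by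
      refine (hιp _).1 ?_
      show p (s (d (l + 1) x)) = 0
      rw [hs']
      apply hf
      rw [hr, (hd _).apply_apply_eq_zero, map_zero])
    obtain ⟨v, hv⟩ := (hQ Q _ _ hQp l (φ.comp t)).1 (by
      ext x
      show φ (t (d l x)) = 0
      have : t (d l x) = 0 := by
        apply hι
        rw [ht]
        simp [(hd l).apply_apply_eq_zero x]
      rw [this, map_zero])
    have hv' : ∀ x, v (d (l + 1) x) = φ (t x) := fun x => LinearMap.congr_fun hv x
    obtain ⟨e, he⟩ := exists_factor_surj (ι.coprod s) (fun b => by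
      obtain ⟨y, hy⟩ := (hd (l + 1 + 1) (f (p b))).1 (hfd.apply_apply_eq_zero _)
      have hy2 : r y = p b := hf (by rw [hr, hy])
      obtain ⟨a, ha⟩ := (hιp (b - s y)).1 (by rw [map_sub, hs', hy2, sub_self])
      exact ⟨(a, y), by simp [ha]⟩) (φ.coprod v) (by
      rintro ⟨a, x⟩ h
      have h : ι a + s x = 0 := by simpa using h
      have h1 : r x = 0 := by
        have := congrArg p h
        rwa [map_add, hιp.apply_apply_eq_zero, zero_add, hs', map_zero] at this
      have h2 : d (l + 1 + 1) x = 0 := by rw [← hr, h1, map_zero]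
      obtain ⟨y, rfl⟩ := (hd (l + 1) x).1 h2
      have h3 : a + t y = 0 := hι (by
        rw [map_add, ht, map_zero]; exact h)
      simp only [LinearMap.coprod_apply]
      rw [hv', ← map_add, h3, map_zero])
    exact ⟨e, fun a => by simpa using he (a, 0)⟩
  induction k with
  | zero => exact key
  | succ k ih =>
    intro i M _ _ f hf hfd
    refine ⟨key i M f hf hfd, P i, _, _, f, hP i, hf, ?_⟩
    refine ih (i + 1) _ ((LinearMap.range f).liftQ (d i) ?_) ?_ ?_
    · rintro _ ⟨m, rfl⟩
      exact hfd.apply_apply_eq_zero m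
    · rw [injective_iff_map_eq_zero]
      intro x
      obtain ⟨x, rfl⟩ := Submodule.mkQ_surjective _ x
      intro h
      exact (Submodule.Quotient.mk_eq_zero _).2 ((hfd x).1 h)
    · intro y
      constructor
      · intro h
        obtain ⟨x, rfl⟩ := (hd i y).1 h
        exact ⟨Submodule.Quotient.mk x, rfl⟩
      · rintro ⟨x, rfl⟩
        obtain ⟨x, rfl⟩ := Submodule.mkQ_surjective _ x
        exact (hd i).apply_apply_eq_zero x

lemma GorensteinProjective.gdepth {S : Type u} [Ring S] {M : Type u} [AddCommGroup M]
    [Module S M] (h : GorensteinProjective S M) (k : ℕ) : GDepth S k M := by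
  obtain ⟨P, _, _, d, hP, hd, ⟨e⟩, hQ⟩ := h
  refine gdepth_of_complex P d hP hd hQ k 0 M
    ((LinearMap.ker (d 0)).subtype.comp e.toLinearMap) ?_ ?_
  · exact Subtype.val_injective.comp e.injective
  · intro x
    constructor
    · intro hx
      exact ⟨e.symm ⟨x, hx⟩, by simp⟩
    · rintro ⟨y, rfl⟩
      exact (e y).2

/-- The hull lemma, for any class `X` containing the projectives and closed under cokernels
of monomorphisms into projectives. -/
lemma exists_hull {S : Type u} [Ring S]
    (X : ∀ (N : Type u) [AddCommGroup N] [Module S N], Prop)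
    (hXP : ∀ (N : Type u) [AddCommGroup N] [Module S N], Module.Projective S N → X N)
    (hXq : ∀ (W P : Type u) [AddCommGroup W] [Module S W] [AddCommGroup P] [Module S P]
      (e : W →ₗ[S] P), Function.Injective e → X W → X P → X (P ⧸ LinearMap.range e)) (n : ℕ) :
    ∀ (k : ℕ) (M : Type u) [AddCommGroup M] [Module S M],
      HasLeftResolutionLE S (fun N _ _ => GorensteinProjective S N) M n →
      ∃ (W H : Type u) (_ : AddCommGroup W) (_ : Module S W) (_ : AddCommGroup H)
        (_ : Module S H) (i : M →ₗ[S] W) (p : W →ₗ[S] H), Function.Injective i ∧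
        Function.Exact i p ∧ Function.Surjective p ∧ X W ∧ GDepth S k H := by
  induction n with
  | zero =>
    rintro k M _ _ ⟨G, _, _, d, π, hG, h0, hπ, hdπ, hd⟩
    have hπi : Function.Injective π := by
      rw [injective_iff_map_eq_zero]
      intro x hx
      obtain ⟨y, rfl⟩ := (hdπ x).1 hx
      have := h0 1 one_pos
      have hy : y = 0 := @Subsingleton.elim (G (0 + 1)) this y 0
      rw [hy, map_zero]
    obtain ⟨-, P, _, _, f, hP, hf, hk⟩ := (hG 0).gdepth (k + 1)
    let e := LinearEquiv.ofBijective π ⟨hπi, hπ⟩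
    refine ⟨P, _, _, _, _, _, f.comp e.symm.toLinearMap, (LinearMap.range f).mkQ,
      hf.comp e.symm.injective, ?_, Submodule.mkQ_surjective _, hXP P hP, hk⟩
    intro x
    constructor
    · intro hx
      obtain ⟨g, rfl⟩ := (Submodule.Quotient.mk_eq_zero _).1 hx
      exact ⟨e g, by simp⟩
    · rintro ⟨m, rfl⟩
      exact (Submodule.Quotient.mk_eq_zero _).2 ⟨e.symm m, rfl⟩
  | succ n ih =>
    rintro k M _ _ ⟨G, _, _, d, π, hG, h0, hπ, hdπ, hd⟩
    let L := LinearMap.ker π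
    let j : L →ₗ[S] G 0 := L.subtype
    have hL : HasLeftResolutionLE S (fun N _ _ => GorensteinProjective S N) L n := by
      refine ⟨fun i => G (i + 1), _, _, fun i => d (i + 1),
        (d 0).codRestrict L (fun x => hdπ.apply_apply_eq_zero x), fun i => hG _,
        fun i hi => h0 _ (by omega), ?_, ?_, fun i => hd _⟩
      · rintro ⟨x, hx⟩
        obtain ⟨y, hy⟩ := (hdπ x).1 hx
        exact ⟨y, Subtype.ext hy⟩
      · intro x
        rw [← hd 0 x]
        exact ⟨fun h => congrArg Subtype.val h, fun h => Subtype.ext h⟩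
    obtain ⟨W, H, _, _, _, _, w, h, hw, hwh, hh, hXW, hH⟩ := ih (k + 1) L hL
    let N : Submodule S (G 0 × W) := LinearMap.range (j.prod (-w))
    let D := (G 0 × W) ⧸ N
    have hDd : GDepth S (k + 1) D := by
      refine GDepth.ext (k + 1) (N.mkQ.comp (LinearMap.inl S (G 0) W))
        (N.liftQ (h.comp (LinearMap.snd S (G 0) W)) ?_) ?_ ?_ ?_ ((hG 0).gdepth _) hH
      · rintro _ ⟨l, rfl⟩
        simp [hwh.apply_apply_eq_zero]
      · rw [injective_iff_map_eq_zero]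
        intro g hg
        obtain ⟨l, hl⟩ := (Submodule.Quotient.mk_eq_zero N).1 hg
        have h1 : j l = g := congrArg Prod.fst hl
        have h2 : -w l = 0 := congrArg Prod.snd hl
        rw [← h1, hw ((neg_eq_zero.1 h2).trans (map_zero w).symm), map_zero]
      · intro x
        obtain ⟨⟨g, y⟩, rfl⟩ := Submodule.mkQ_surjective _ x
        constructor
        · intro hx
          obtain ⟨l, hl⟩ := (hwh y).1 hx
          refine ⟨g + j l, (Submodule.Quotient.eq N).2 ⟨l, ?_⟩⟩
          ext
          · simp
          · simp [hl]
        · rintro ⟨g', hg'⟩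
          rw [← hg']
          exact map_zero h
      · intro z
        obtain ⟨y, rfl⟩ := hh z
        exact ⟨N.mkQ (0, y), rfl⟩
    obtain ⟨-, P, _, _, f, hP, hf, hk⟩ := hDd
    let e : W →ₗ[S] P := f.comp (N.mkQ.comp (LinearMap.inr S (G 0) W))
    have he : Function.Injective e := by
      rw [injective_iff_map_eq_zero]
      intro y hy
      have hy' : N.mkQ (0, y) = 0 := hf (hy.trans (map_zero f).symm)
      obtain ⟨l, hl⟩ := (Submodule.Quotient.mk_eq_zero N).1 hy'
      have h1 : (l : G 0) = 0 := congrArg Prod.fst hl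
      have h2 : -w l = y := congrArg Prod.snd hl
      have h3 : l = 0 := Subtype.ext h1
      rw [← h2, h3, map_zero, neg_zero]
    let W' := P ⧸ LinearMap.range e
    let u : G 0 →ₗ[S] W' :=
      (LinearMap.range e).mkQ.comp (f.comp (N.mkQ.comp (LinearMap.inl S (G 0) W)))
    have hu : ∀ g, u g = 0 ↔ π g = 0 := by
      intro g
      constructor
      · intro hg
        obtain ⟨y, hy⟩ := (Submodule.Quotient.mk_eq_zero (LinearMap.range e)).1 hg
        have hy' : N.mkQ (0, y) = N.mkQ (g, 0) := hf hy
        obtain ⟨l, hl⟩ := (Submodule.Quotient.eq N).1 hy'.symm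
        have h1 : (l : G 0) = g - 0 := congrArg Prod.fst hl
        rw [← sub_zero g, ← h1]
        exact l.2
      · intro hg
        refine (Submodule.Quotient.mk_eq_zero (LinearMap.range e)).2 ⟨w ⟨g, hg⟩, ?_⟩
        show f (N.mkQ (0, w ⟨g, hg⟩)) = f (N.mkQ (g, 0))
        congr 1
        refine ((Submodule.Quotient.eq N).2 ⟨⟨g, hg⟩, ?_⟩).symm
        ext
        · simp [j]
        · simp
    obtain ⟨i, hi⟩ := exists_factor_surj π hπ u (fun x hx => (hu x).2 hx)
    have hle : LinearMap.range e ≤ (LinearMap.range f).comap LinearMap.id := by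
      rintro _ ⟨y, rfl⟩
      exact ⟨_, rfl⟩
    refine ⟨W', P ⧸ LinearMap.range f, _, _, _, _, i, Submodule.mapQ _ _ LinearMap.id hle,
      ?_, ?_, ?_, hXq W P e he hXW (hXP P hP), hk⟩
    · rw [injective_iff_map_eq_zero]
      intro m hm
      obtain ⟨g, rfl⟩ := hπ m
      rw [hi] at hm
      exact (hu g).1 hm
    · intro x
      obtain ⟨x, rfl⟩ := Submodule.mkQ_surjective _ x
      constructor
      · intro hx
        obtain ⟨y, hy⟩ := (Submodule.Quotient.mk_eq_zero (LinearMap.range f)).1 hx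
        obtain ⟨⟨g, y⟩, rfl⟩ := Submodule.mkQ_surjective _ y
        refine ⟨π g, ?_⟩
        rw [hi]
        refine (Submodule.Quotient.eq (LinearMap.range e)).2 ⟨-y, ?_⟩
        have hx2 : x = f (N.mkQ (g, y)) := hy.symm
        rw [hx2]
        show f (N.mkQ (0, -y)) = f (N.mkQ (g, 0)) - f (N.mkQ (g, y))
        rw [← map_sub f, ← map_sub N.mkQ]
        simp only [Prod.mk_sub_mk, sub_self, zero_sub]
      · rintro ⟨m, hm⟩
        obtain ⟨g, rfl⟩ := hπ m
        rw [hi] at hm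
        rw [← hm]
        exact (Submodule.Quotient.mk_eq_zero (LinearMap.range f)).2 ⟨_, rfl⟩
    · intro z
      obtain ⟨z, rfl⟩ := Submodule.mkQ_surjective _ z
      exact ⟨Submodule.Quotient.mk z, rfl⟩

end Helpers

section TensorHelpers

open TensorProduct

variable {R : Type u} [Ring R]

/-- Pure tensors. -/
noncomputable def bt {N : Type u} [AddCommGroup N] [Module Rᵐᵒᵖ N]
    {M : Type u} [AddCommGroup M] [Module R M] (n : N) (m : M) : bTensor R N M :=
  QuotientAddGroup.mk (n ⊗ₜ[ℤ] m)

section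

variable {N : Type u} [AddCommGroup N] [Module Rᵐᵒᵖ N] {M : Type u} [AddCommGroup M] [Module R M]
  {N' : Type u} [AddCommGroup N'] [Module Rᵐᵒᵖ N'] {M' : Type u} [AddCommGroup M'] [Module R M']

lemma bt_add_left (n n' : N) (m : M) : bt (R := R) (n + n') m = bt n m + bt n' m := by
  unfold bt; rw [add_tmul]; rfl

lemma bt_add_right (n : N) (m m' : M) : bt (R := R) n (m + m') = bt n m + bt n m' := by
  unfold bt; rw [tmul_add]; rfl

lemma bt_smul (r : R) (n : N) (m : M) : bt (R := R) (MulOpposite.op r • n) m = bt n (r • m) := by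
  unfold bt
  refine (QuotientAddGroup.eq_iff_sub_mem).2 ?_
  exact AddSubgroup.subset_closure ⟨r, n, m, rfl⟩

lemma tmapRight_bt (f : M →ₗ[R] M') (n : N) (m : M) : tmapRight R N f (bt n m) = bt n (f m) := rfl

lemma tmapLeft_bt (g : N →ₗ[Rᵐᵒᵖ] N') (n : N) (m : M) :
    tmapLeft R M g (bt n m) = bt (g n) m := rfl

lemma bt_induction {p : bTensor R N M → Prop} (h : ∀ n m, p (bt n m)) (h0 : p 0)
    (ha : ∀ x y, p x → p y → p (x + y)) (x : bTensor R N M) : p x := by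
  obtain ⟨x, rfl⟩ := QuotientAddGroup.mk_surjective x
  induction x with
  | zero => exact h0
  | tmul n m => exact h n m
  | add x y hx hy => exact ha _ _ hx hy

lemma bt_hom_ext {A : Type*} [AddCommGroup A] {f g : bTensor R N M →+ A}
    (h : ∀ n m, f (bt n m) = g (bt n m)) (x) : f x = g x := by
  induction x using bt_induction with
  | h n m => exact h n m
  | h0 => simp
  | ha x y hx hy => rw [map_add, map_add, hx, hy]

/-- Universal property. -/
lemma exists_btLift {A : Type u} [AddCommGroup A] (φ : N →+ M →+ A)
    (h : ∀ (r : R) n m, φ (MulOpposite.op r • n) m = φ n (r • m)) :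
    ∃ F : bTensor R N M →+ A, ∀ n m, F (bt n m) = φ n m := by
  refine ⟨QuotientAddGroup.lift _ (TensorProduct.liftAddHom φ (by simp)) ?_,
    fun n m => ?_⟩
  · rw [tensorRel, AddSubgroup.closure_le]
    rintro x ⟨r, n, m, rfl⟩
    simp [h]
  · simp [bt]

lemma tmap_comm (g : N →ₗ[Rᵐᵒᵖ] N') (f : M →ₗ[R] M') (x : bTensor R N M) :
    tmapLeft R M' g (tmapRight R N f x) = tmapRight R N' f (tmapLeft R M g x) :=
  bt_hom_ext (f := (tmapLeft R M' g).comp (tmapRight R N f))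
    (g := (tmapRight R N' f).comp (tmapLeft R M g)) (fun _ _ => rfl) x

lemma tmapLeft_surj (g : N →ₗ[Rᵐᵒᵖ] N') (hg : Function.Surjective g) :
    Function.Surjective (tmapLeft R M g) := by
  intro x
  induction x using bt_induction with
  | h n m =>
    obtain ⟨n, rfl⟩ := hg n
    exact ⟨bt n m, rfl⟩
  | h0 => exact ⟨0, map_zero _⟩
  | ha x y hx hy =>
    obtain ⟨x, rfl⟩ := hx
    obtain ⟨y, rfl⟩ := hy
    exact ⟨x + y, map_add _ _ _⟩

end

lemma tmapLeft_exact {A B C : Type u} [AddCommGroup A] [Module Rᵐᵒᵖ A] [AddCommGroup B]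
    [Module Rᵐᵒᵖ B] [AddCommGroup C] [Module Rᵐᵒᵖ C] {M : Type u} [AddCommGroup M] [Module R M]
    (f : A →ₗ[Rᵐᵒᵖ] B) (g : B →ₗ[Rᵐᵒᵖ] C) (hfg : Function.Exact f g)
    (hg : Function.Surjective g) : Function.Exact (tmapLeft R M f) (tmapLeft R M g) := by
  intro x
  constructor
  · obtain ⟨x, rfl⟩ := QuotientAddGroup.mk_surjective x
    intro hx
    have hx' : LinearMap.rTensor M (g.restrictScalars ℤ) x ∈ tensorRel R C M :=
      (QuotientAddGroup.eq_zero_iff _).1 hx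
    have hle : tensorRel R C M ≤ (tensorRel R B M).map
        (LinearMap.rTensor M (g.restrictScalars ℤ)).toAddMonoidHom := by
      rw [tensorRel, AddSubgroup.closure_le]
      rintro _ ⟨r, n, m, rfl⟩
      obtain ⟨n, rfl⟩ := hg n
      refine ⟨_, AddSubgroup.subset_closure ⟨r, n, m, rfl⟩, ?_⟩
      simp
    obtain ⟨y, hy, hyx⟩ := hle hx'
    have hex : Function.Exact (LinearMap.rTensor M (f.restrictScalars ℤ))
        (LinearMap.rTensor M (g.restrictScalars ℤ)) :=
      rTensor_exact M (f := f.restrictScalars ℤ) (g := g.restrictScalars ℤ) hfg hg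
    obtain ⟨z, hz⟩ := (hex (x - y)).1 (by
      rw [map_sub, sub_eq_zero]
      exact hyx.symm)
    refine ⟨QuotientAddGroup.mk z, ?_⟩
    show QuotientAddGroup.mk (LinearMap.rTensor M (f.restrictScalars ℤ) z) = _
    rw [hz]
    refine (QuotientAddGroup.eq_iff_sub_mem).2 ?_
    simpa using (neg_mem hy)
  · rintro ⟨y, rfl⟩
    refine bt_hom_ext (f := (tmapLeft R M g).comp (tmapLeft R M f)) (g := 0) (fun n m => ?_) y
    show bt (g (f n)) m = 0
    rw [hfg.apply_apply_eq_zero]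
    simp [bt]

/-- For `Q` projective, `Q ⊗ -` is a natural retract of `Q →₀ -`. -/
lemma tmapRight_exact_of_projective {Q : Type u} [AddCommGroup Q] [Module Rᵐᵒᵖ Q]
    (hQ : Module.Projective Rᵐᵒᵖ Q) {A B C : Type u} [AddCommGroup A] [Module R A]
    [AddCommGroup B] [Module R B] [AddCommGroup C] [Module R C] (f : A →ₗ[R] B) (g : B →ₗ[R] C)
    (hfg : Function.Exact f g) : Function.Exact (tmapRight R Q f) (tmapRight R Q g) := by
  obtain ⟨s, hs⟩ := hQ.out
  -- coordinates
  have hφ : ∀ (M : Type u) [AddCommGroup M] [Module R M] (q : Q), ∃ F : bTensor R Q M →+ M,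
      ∀ n m, F (bt n m) = (s n q).unop • m := by
    intro M _ _ q
    refine exists_btLift (AddMonoidHom.mk' (fun n => AddMonoidHom.mk' (fun m => (s n q).unop • m)
      (by intros; rw [smul_add])) ?_) ?_
    · intro a b
      ext m
      simp [add_smul]
    · intro r n m
      simp [mul_smul]
  choose F hF using fun (M : Type u) (i : AddCommGroup M) (j : Module R M) (q : Q) => hφ M q
  have nat : ∀ q (x : bTensor R Q B), F C _ _ q (tmapRight R Q g x) = g (F B _ _ q x) := by
    intro q x
    refine bt_hom_ext (f := (F C _ _ q).comp (tmapRight R Q g))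
      (g := g.toAddMonoidHom.comp (F B _ _ q)) (fun n m => ?_) x
    simp [tmapRight_bt, hF]
  -- reconstruction
  have rec1 : ∀ x : bTensor R Q B, ∃ t : Finset Q, ∀ t', t ⊆ t' →
      x = ∑ q ∈ t', bt q (F B _ _ q x) := by
    intro x
    induction x using bt_induction with
    | h n m =>
      refine ⟨(s n).support, fun t' ht' => ?_⟩
      have h1 : n = ∑ q ∈ t', s n q • q := by
        have := hs n
        rw [Finsupp.linearCombination_apply, Finsupp.sum_of_support_subset _ ht' _ (by simp)] at this
        exact this.symm
      let T : Q →+ bTensor R Q B := AddMonoidHom.mk' (fun q => bt q m)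
        (fun a b => bt_add_left a b m)
      have h2 : T n = T (∑ q ∈ t', s n q • q) := congrArg T h1
      rw [map_sum] at h2
      refine h2.trans (Finset.sum_congr rfl fun q _ => ?_)
      rw [hF, ← bt_smul]
      rfl
    | h0 => exact ⟨∅, fun t' _ => by simp [bt]⟩
    | ha x y hx hy =>
      classical
      obtain ⟨t1, h1⟩ := hx
      obtain ⟨t2, h2⟩ := hy
      refine ⟨t1 ∪ t2, fun t' ht' => ?_⟩
      simp only [map_add, bt_add_right, Finset.sum_add_distrib]
      rw [← h1 t' (Finset.union_subset_left ht'), ← h2 t' (Finset.union_subset_right ht')]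
  intro x
  constructor
  · intro hx
    obtain ⟨t, ht⟩ := rec1 x
    have h0 : ∀ q, ∃ a, f a = F B _ _ q x := fun q => (hfg _).1 (by
      rw [← nat, hx, map_zero])
    choose a ha using h0
    refine ⟨∑ q ∈ t, bt q (a q), ?_⟩
    rw [map_sum]
    conv_rhs => rw [ht t subset_rfl]
    refine Finset.sum_congr rfl fun q _ => ?_
    rw [tmapRight_bt, ha]
  · rintro ⟨y, rfl⟩
    refine bt_hom_ext (f := (tmapRight R Q g).comp (tmapRight R Q f)) (g := 0) (fun n m => ?_) y
    show bt n (g (f m)) = 0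
    rw [hfg.apply_apply_eq_zero]
    simp [bt]

lemma modFlat_of_projective {M : Type u} [AddCommGroup M] [Module R M]
    (hM : Module.Projective R M) : ModFlat R M := by
  intro N N' _ _ _ _ g hg
  obtain ⟨s, hs⟩ := hM.out
  have hφ : ∀ (A : Type u) [AddCommGroup A] [Module Rᵐᵒᵖ A] (q : M), ∃ F : bTensor R A M →+ A,
      ∀ n m, F (bt n m) = MulOpposite.op (s m q) • n := by
    intro A _ _ q
    refine exists_btLift (AddMonoidHom.mk' (fun n => AddMonoidHom.mk'
      (fun m => MulOpposite.op (s m q) • n) (by intros; simp [add_smul])) ?_) ?_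
    · intro a b
      ext m
      simp
    · intro r n m
      simp [mul_smul]
  choose F hF using fun (A : Type u) (i : AddCommGroup A) (j : Module Rᵐᵒᵖ A) (q : M) => hφ A q
  have nat : ∀ q (x : bTensor R N M), F N' _ _ q (tmapLeft R M g x) = g (F N _ _ q x) := by
    intro q x
    refine bt_hom_ext (f := (F N' _ _ q).comp (tmapLeft R M g))
      (g := g.toAddMonoidHom.comp (F N _ _ q)) (fun n m => ?_) x
    simp [tmapLeft_bt, hF]
  have rec1 : ∀ x : bTensor R N M, ∃ t : Finset M, ∀ t', t ⊆ t' →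
      x = ∑ q ∈ t', bt (F N _ _ q x) q := by
    intro x
    induction x using bt_induction with
    | h n m =>
      refine ⟨(s m).support, fun t' ht' => ?_⟩
      have h1 : m = ∑ q ∈ t', s m q • q := by
        have := hs m
        rw [Finsupp.linearCombination_apply, Finsupp.sum_of_support_subset _ ht' _ (by simp)] at this
        exact this.symm
      let T : M →+ bTensor R N M := AddMonoidHom.mk' (fun q => bt n q)
        (fun a b => bt_add_right n a b)
      have h2 : T m = T (∑ q ∈ t', s m q • q) := congrArg T h1
      rw [map_sum] at h2
      refine h2.trans (Finset.sum_congr rfl fun q _ => ?_)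
      rw [hF, bt_smul]
      rfl
    | h0 => exact ⟨∅, fun t' _ => by simp [bt]⟩
    | ha x y hx hy =>
      classical
      obtain ⟨t1, h1⟩ := hx
      obtain ⟨t2, h2⟩ := hy
      refine ⟨t1 ∪ t2, fun t' ht' => ?_⟩
      simp only [map_add, bt_add_left, Finset.sum_add_distrib]
      rw [← h1 t' (Finset.union_subset_left ht'), ← h2 t' (Finset.union_subset_right ht')]
  rw [injective_iff_map_eq_zero]
  intro x hx
  obtain ⟨t, ht⟩ := rec1 x
  rw [ht t subset_rfl]
  refine Finset.sum_eq_zero fun q _ => ?_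
  have : F N _ _ q x = 0 := hg (by rw [← nat, hx, map_zero, map_zero])
  rw [this]
  simp [bt]

/-- Right modules `E` such that `E ⊗ P` is exact for every exact complex of projectives. -/
def TAcyc (R : Type u) [Ring R] (E : Type u) [AddCommGroup E] [Module Rᵐᵒᵖ E] : Prop :=
  ∀ (P : ℤ → Type u) (_ : ∀ i, AddCommGroup (P i)) (_ : ∀ i, Module R (P i))
    (d : ∀ i, P i →ₗ[R] P (i + 1)), (∀ i, Module.Projective R (P i)) →
    (∀ i, Function.Exact (d i) (d (i + 1))) →
    ∀ i, Function.Exact (tmapRight R E (d i)) (tmapRight R E (d (i + 1)))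

lemma tAcyc_quot (W P : Type u) [AddCommGroup W] [Module Rᵐᵒᵖ W] [AddCommGroup P]
    [Module Rᵐᵒᵖ P] (e : W →ₗ[Rᵐᵒᵖ] P) (he : Function.Injective e) (hW : TAcyc R W)
    (hP : TAcyc R P) : TAcyc R (P ⧸ LinearMap.range e) := by
  intro C _ _ d hC hd i
  let q := (LinearMap.range e).mkQ
  have hq : Function.Surjective q := Submodule.mkQ_surjective _
  have heq : Function.Exact e q := LinearMap.exact_map_mkQ_range e
  have hWi := hW C _ _ d hC hd
  have hPi := hP C _ _ d hC hd
  intro x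
  constructor
  · intro hx
    obtain ⟨y, rfl⟩ := tmapLeft_surj q hq x
    rw [← tmap_comm] at hx
    obtain ⟨z, hz⟩ := (tmapLeft_exact e q heq hq _).1 hx
    have hdz : tmapRight R W (d (i + 1 + 1)) z = 0 := by
      apply modFlat_of_projective (hC (i + 1 + 1 + 1)) _ _ _ _ _ _ e he
      rw [tmap_comm, hz, (hPi (i + 1)).apply_apply_eq_zero, map_zero]
    obtain ⟨w, rfl⟩ := (hWi (i + 1) z).1 hdz
    rw [tmap_comm] at hz
    obtain ⟨v, hv⟩ := (hPi i (y - tmapLeft R _ e w)).1 (by rw [map_sub, hz, sub_self])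
    refine ⟨tmapLeft R _ q v, ?_⟩
    rw [← tmap_comm, hv, map_sub, (tmapLeft_exact e q heq hq).apply_apply_eq_zero, sub_zero]
  · rintro ⟨y, rfl⟩
    obtain ⟨y, rfl⟩ := tmapLeft_surj q hq y
    rw [← tmap_comm, ← tmap_comm, (hPi i).apply_apply_eq_zero, map_zero]

lemma tAcyc_retract {E W : Type u} [AddCommGroup W] [Module Rᵐᵒᵖ W] [AddCommGroup E]
    [Module Rᵐᵒᵖ E] (i : E →ₗ[Rᵐᵒᵖ] W) (r : W →ₗ[Rᵐᵒᵖ] E) (hr : ∀ x, r (i x) = x)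
    (hW : TAcyc R W) : TAcyc R E := by
  intro C _ _ d hC hd k
  have hWi := hW C _ _ d hC hd
  have hri : ∀ (M : Type u) [AddCommGroup M] [Module R M] (x : bTensor R E M),
      tmapLeft R M r (tmapLeft R M i x) = x := by
    intro M _ _ x
    refine bt_hom_ext (f := (tmapLeft R M r).comp (tmapLeft R M i)) (g := AddMonoidHom.id _)
      (fun n m => ?_) x
    show bt (r (i n)) m = bt n m
    rw [hr]
  intro x
  constructor
  · intro hx
    obtain ⟨y, hy⟩ := (hWi k (tmapLeft R _ i x)).1 (by rw [← tmap_comm, hx, map_zero])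
    exact ⟨tmapLeft R _ r y, by rw [← tmap_comm, hy, hri]⟩
  · rintro ⟨y, rfl⟩
    rw [← hri _ (tmapRight R E (d (k + 1)) (tmapRight R E (d k) y)), tmap_comm i, tmap_comm i,
      (hWi k).apply_apply_eq_zero, map_zero]

lemma tAcyc_of_injective (h : GPgldim Rᵐᵒᵖ ≠ ⊤) (E : Type u) [AddCommGroup E] [Module Rᵐᵒᵖ E]
    (hE : Module.Injective Rᵐᵒᵖ E) : TAcyc R E := by
  have hE' : gpDim Rᵐᵒᵖ E ≠ ⊤ := ne_top_of_le_ne_top h (le_sSup ⟨E, _, _, rfl⟩)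
  obtain ⟨n, hn⟩ : ∃ n : ℕ,
      HasLeftResolutionLE Rᵐᵒᵖ (fun N _ _ => GorensteinProjective Rᵐᵒᵖ N) E n := by
    by_contra hcon
    push Not at hcon
    apply hE'
    rw [gpDim]
    simp [hcon]
  obtain ⟨W, H, _, _, _, _, i, p, hi, -, -, hW, -⟩ := exists_hull (S := Rᵐᵒᵖ)
    (fun N _ _ => TAcyc R N)
    (fun N _ _ hN C _ _ d hC hd k => tmapRight_exact_of_projective hN _ _ (hd k))
    (fun W P _ _ _ _ e he hW hP => tAcyc_quot W P e he hW hP) n 0 E hn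
  obtain ⟨r, hr⟩ := hE.out i hi LinearMap.id
  exact tAcyc_retract i r hr hW

lemma gorensteinFlat_of_gp (h : GPgldim Rᵐᵒᵖ ≠ ⊤) (M : Type u) [AddCommGroup M] [Module R M]
    (hM : GorensteinProjective R M) : GorensteinFlat R M := by
  obtain ⟨P, _, _, d, hP, hd, e, -⟩ := hM
  exact ⟨P, _, _, d, fun i => modFlat_of_projective (hP i), hd, e,
    fun E _ _ hE => tAcyc_of_injective h E hE P _ _ d hP hd⟩

end TensorHelpers

/-- `l.wGgldim(R) ≤ sup { l.Ggldim(R), r.Ggldim(R) }`. -/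
theorem GFgldim_le_sup (R : Type u) [Ring R] :
    GFgldim R ≤ max (GPgldim R) (GPgldim Rᵐᵒᵖ) := by
  by_cases h : GPgldim Rᵐᵒᵖ = ⊤
  · simp [h]
  · refine le_max_of_le_left (sSup_le ?_)
    rintro _ ⟨M, _, _, rfl⟩
    have hM : gpDim R M ≤ GPgldim R := le_sSup ⟨M, _, _, rfl⟩
    refine le_trans ?_ hM
    refine sInf_le_sInf (Set.image_mono ?_)
    rintro n ⟨G, _, _, d, π, hG, h'⟩
    exact ⟨G, _, _, d, π, fun i => gorensteinFlat_of_gp h _ (hG i), h'⟩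
end

section
/- If the weak global dimension of R is finite, then the left finitistic projective dimension, the left Gorenstein global dimension, and the left global dimension of R all coincide. -/
/-! Definitions for Gorenstein homological algebra over an arbitrary
associative ring `R` (left modules; right modules are `Rᵐᵒᵖ`-modules). -/

universe u

section Homol
open CategoryTheory Abelian

variable {R : Type u} [Ring R]

/-- Projective dimension `< n`, via Mathlib's `Ext`. -/
def PdLT (R : Type u) [Ring R] (M : Type u) [AddCommGroup M] [Module R M] (n : ℕ) : Prop :=
  HasProjectiveDimensionLT (ModuleCat.of R M) n

/-- Vanishing of `Ext^n(M, N)`. -/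
def ExtZ (R : Type u) [Ring R] (M N : Type u) [AddCommGroup M] [Module R M]
    [AddCommGroup N] [Module R N] (n : ℕ) : Prop :=
  ∀ e : Ext (ModuleCat.of R M) (ModuleCat.of R N) n, e = 0

section
variable {A B C M N : Type u} [AddCommGroup A] [Module R A] [AddCommGroup B] [Module R B]
    [AddCommGroup C] [Module R C] [AddCommGroup M] [Module R M] [AddCommGroup N] [Module R N]

/-- The short complex attached to an exact pair. -/
abbrev sesC (f : A →ₗ[R] B) (g : B →ₗ[R] C) (h : Function.Exact f g) :
    ShortComplex (ModuleCat.{u} R) :=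
  ShortComplex.mk (ModuleCat.ofHom f) (ModuleCat.ofHom g) (by
    ext x; exact h.apply_apply_eq_zero x)

lemma ses_exact {f : A →ₗ[R] B} {g : B →ₗ[R] C} (h : IsSES R f g) :
    (sesC f g h.2.1).ShortExact where
  exact := (ShortComplex.ShortExact.moduleCat_exact_iff_function_exact _).mpr h.2.1
  mono_f := (ModuleCat.mono_iff_injective _).2 h.1
  epi_g := (ModuleCat.epi_iff_surjective _).2 h.2.2

lemma pdLT_mono {n m : ℕ} (h : PdLT R M n) (hnm : n ≤ m) : PdLT R M m := by
  have := h
  unfold PdLT at *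
  exact hasProjectiveDimensionLT_of_ge _ n m hnm

lemma pdLT_equiv (e : M ≃ₗ[R] N) {n : ℕ} (h : PdLT R M n) : PdLT R N n := by
  unfold PdLT at *
  exact hasProjectiveDimensionLT_of_iso e.toModuleIso n

lemma pdLT_mid {f : A →ₗ[R] B} {g : B →ₗ[R] C} (h : IsSES R f g) {n : ℕ}
    (h1 : PdLT R A n) (h3 : PdLT R C n) : PdLT R B n :=
  (ses_exact h).hasProjectiveDimensionLT_X₂ n h1 h3

lemma pdLT_right {f : A →ₗ[R] B} {g : B →ₗ[R] C} (h : IsSES R f g) {n : ℕ}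
    (h1 : PdLT R A n) (h2 : PdLT R B (n + 1)) : PdLT R C (n + 1) :=
  (ses_exact h).hasProjectiveDimensionLT_X₃ n h1 h2

lemma pdLT_left {f : A →ₗ[R] B} {g : B →ₗ[R] C} (h : IsSES R f g) {n : ℕ}
    (h2 : PdLT R B n) (h3 : PdLT R C (n + 1)) : PdLT R A n :=
  (ses_exact h).hasProjectiveDimensionLT_X₁ n h2 h3

lemma pdLT_one_iff : PdLT R M 1 ↔ Module.Projective R M := by
  rw [IsProjective.iff_projective, projective_iff_hasProjectiveDimensionLT_one]; rfl

lemma pdLT_of_ext {n : ℕ} (h : ∀ (N : Type u) [AddCommGroup N] [Module R N], ExtZ R M N n) :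
    PdLT R M n := by
  refine hasProjectiveDimensionLT_of_enoughInjectives _ n fun Y => ?_
  exact ⟨fun a b => (h Y a).trans (h Y b).symm⟩

lemma ext_of_pdLT {n i : ℕ} (h : PdLT R M n) (hi : n ≤ i) : ExtZ R M N i := by
  intro e
  have : HasProjectiveDimensionLT (ModuleCat.of R M) n := h
  exact e.eq_zero_of_hasProjectiveDimensionLT n hi

lemma extZ_equiv (e : M ≃ₗ[R] N) {n : ℕ} (h : ExtZ R M A n) : ExtZ R N A n := by
  intro x
  have h1 := h ((Ext.mk₀ e.toModuleIso.hom).comp x (zero_add n))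
  have h2 : (Ext.mk₀ e.toModuleIso.inv).comp
      ((Ext.mk₀ e.toModuleIso.hom).comp x (zero_add n)) (zero_add n) = x := by
    rw [← Ext.comp_assoc_of_second_deg_zero, Ext.mk₀_comp_mk₀, Iso.inv_hom_id, Ext.mk₀_id_comp]
  rw [← h2, h1]; simp

/-- covariant middle: `Ext^n(M,B) = 0`, `Ext^{n+1}(M,A) = 0` give `Ext^n(M,C) = 0`. -/
lemma extZ_cov {f : A →ₗ[R] B} {g : B →ₗ[R] C} (h : IsSES R f g) {n : ℕ}
    (h2 : ExtZ R M B n) (h1 : ExtZ R M A (n + 1)) : ExtZ R M C n := by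
  intro e
  obtain ⟨x, hx⟩ := Ext.covariant_sequence_exact₃ _ (ses_exact h) e rfl (h1 _)
  rw [← hx, h2 x]; simp

lemma extZ_cov1 {f : A →ₗ[R] B} {g : B →ₗ[R] C} (h : IsSES R f g) {n : ℕ}
    (h2 : ExtZ R M B (n + 1)) (h1 : ExtZ R M C n) : ExtZ R M A (n + 1) := by
  intro e
  obtain ⟨x, hx⟩ := Ext.covariant_sequence_exact₁ _ (ses_exact h) e (h2 _) rfl
  rw [← hx, h1 x]; simp

/-- contravariant: `Ext^n(A,N)=0` and `Ext^{n+1}(B,N)=0` give `Ext^{n+1}(C,N)=0`. -/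
lemma extZ_contra {f : A →ₗ[R] B} {g : B →ₗ[R] C} (h : IsSES R f g) {n : ℕ}
    (h1 : ExtZ R A N n) (h2 : ExtZ R B N (n + 1)) : ExtZ R C N (n + 1) := by
  intro e
  obtain ⟨x, hx⟩ := Ext.contravariant_sequence_exact₃ (ses_exact h) _ e (h2 _) (add_comm 1 n)
  rw [← hx, h1 x]; simp

lemma extZ_contra_one {f : A →ₗ[R] B} {g : B →ₗ[R] C} (h : IsSES R f g)
    (h1 : ∀ a : A →ₗ[R] N, ∃ b : B →ₗ[R] N, b.comp f = a) (h2 : ExtZ R B N 1) :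
    ExtZ R C N 1 := by
  intro e
  obtain ⟨x, hx⟩ := Ext.contravariant_sequence_exact₃ (ses_exact h) _ e (h2 _) (add_zero 1)
  obtain ⟨a, rfl⟩ := (Ext.mk₀_bijective _ _).2 x
  obtain ⟨b, hb⟩ := h1 a.hom
  have : a = (sesC f g h.2.1).f ≫ ModuleCat.ofHom b := by
    ext x; exact (LinearMap.congr_fun hb x).symm
  rw [← hx, this, ← Ext.mk₀_comp_mk₀, ← Ext.comp_assoc_of_second_deg_zero,
    (ses_exact h).extClass_comp, Ext.zero_comp]

lemma extZ_one_of_lift {f : A →ₗ[R] B} {g : B →ₗ[R] C} (h : IsSES R f g) 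
    (hB : ExtZ R M B 1)
    (hl : ∀ a : M →ₗ[R] C, ∃ b : M →ₗ[R] B, g.comp b = a) : ExtZ R M A 1 := by
  intro e
  obtain ⟨x, hx⟩ := Ext.covariant_sequence_exact₁ _ (ses_exact h) e (hB _) (zero_add 1)
  obtain ⟨a, rfl⟩ := (Ext.mk₀_bijective _ _).2 x
  obtain ⟨b, hb⟩ := hl a.hom
  have : a = ModuleCat.ofHom b ≫ (sesC f g h.2.1).g := by
    ext x; exact (LinearMap.congr_fun hb x).symm
  rw [← hx, this, ← Ext.mk₀_comp_mk₀, Ext.comp_assoc_of_second_deg_zero,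
    (ses_exact h).comp_extClass, Ext.comp_zero]

lemma lift_of_extZ_one {f : A →ₗ[R] B} {g : B →ₗ[R] C} (h : IsSES R f g) 
    (hA : ExtZ R M A 1) (a : M →ₗ[R] C) : ∃ b : M →ₗ[R] B, g.comp b = a := by
  obtain ⟨x, hx⟩ := Ext.covariant_sequence_exact₃ (ModuleCat.of R M) (ses_exact h)
    (Ext.mk₀ (ModuleCat.ofHom a)) (zero_add 1) (hA _)
  obtain ⟨b, rfl⟩ := (Ext.mk₀_bijective _ _).2 x
  rw [Ext.mk₀_comp_mk₀] at hx
  have := (Ext.mk₀_bijective _ _).1 hx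
  refine ⟨b.hom, ?_⟩
  ext x
  exact congrArg (fun t => t.hom x) this

lemma extZ_injective [hB : Module.Injective R B] (n : ℕ) : ExtZ R M B (n + 1) := by
  intro e
  have := Module.injective_object_of_injective_module R B
  exact Ext.eq_zero_of_injective e

lemma extZ_projective [hB : Module.Projective R B] (n : ℕ) : ExtZ R B N (n + 1) :=
  ext_of_pdLT (pdLT_one_iff.2 hB) (by omega)

variable (R) in
lemma exists_inj (N : Type u) [AddCommGroup N] [Module R N] :
    ∃ (E D : Type u) (_ : AddCommGroup E) (_ : Module R E) (_ : AddCommGroup D) (_ : Module R D)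
    (f : N →ₗ[R] E) (g : E →ₗ[R] D), Module.Injective R E ∧ IsSES R f g := by
  obtain ⟨⟨J, hJ, f, hf⟩⟩ := EnoughInjectives.presentation (ModuleCat.of R N)
  refine ⟨J, J ⧸ LinearMap.range f.hom, inferInstance, inferInstance, inferInstance, inferInstance,
    f.hom, Submodule.mkQ _, ?_, ?_, ?_, Submodule.mkQ_surjective _⟩
  · exact Module.injective_module_of_injective_object (inj := hJ) ..
  · exact (ModuleCat.mono_iff_injective f).1 hf
  · exact LinearMap.exact_map_mkQ_range f.hom

variable (R) in
/-- cosyzygies -/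
lemma exists_cosyz (m : ℕ) : ∀ (N : Type u) [AddCommGroup N] [Module R N],
    ∃ (C : Type u) (_ : AddCommGroup C) (_ : Module R C),
      ∀ (X : Type u) [AddCommGroup X] [Module R X], ExtZ R X C 1 ↔ ExtZ R X N (m + 1) := by
  induction m with
  | zero => intro N _ _; exact ⟨N, _, _, fun X _ _ => Iff.rfl⟩
  | succ m ih =>
    intro N _ _
    obtain ⟨E, D, _, _, _, _, f, g, hE, h⟩ := exists_inj R N
    obtain ⟨C, _, _, hC⟩ := ih D
    refine ⟨C, _, _, fun X _ _ => (hC X).trans ⟨fun h1 => extZ_cov1 h (extZ_injective _) h1,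
      fun h1 => extZ_cov h (extZ_injective _) h1⟩⟩

lemma ses_ker (p : B →ₗ[R] C) (hp : Function.Surjective p) :
    IsSES R (LinearMap.ker p).subtype p := by
  refine ⟨Submodule.subtype_injective _, ?_, hp⟩
  exact LinearMap.exact_subtype_ker_map p

lemma ses_quot (S : Submodule R B) : IsSES R S.subtype S.mkQ := by
  refine ⟨Submodule.subtype_injective _, ?_, Submodule.mkQ_surjective _⟩
  exact LinearMap.exact_subtype_mkQ S

/-- If `pd M` is finite and `Ext^i(M, Q) = 0` for all projective `Q`, `i ≥ m`, then `pd M < m`. -/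
lemma pdLT_of_ext_proj {m : ℕ} (h : ∀ i, m ≤ i → ∀ (Q : Type u) [AddCommGroup Q] [Module R Q],
    Module.Projective R Q → ExtZ R M Q i) (k : ℕ) (hk : PdLT R M (m + k)) : PdLT R M m := by
  induction k with
  | zero => exact hk
  | succ k ih =>
    apply ih
    apply pdLT_of_ext
    intro N _ _
    let p : (N →₀ R) →ₗ[R] N := Finsupp.linearCombination R id
    have hp : Function.Surjective p := Finsupp.linearCombination_id_surjective R N
    have hs := ses_ker p hp
    exact extZ_cov hs (h _ (by omega) _ inferInstance) (ext_of_pdLT hk (by omega))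

end

section Eklof
variable {M E D : Type u} [AddCommGroup M] [Module R M] [AddCommGroup E] [Module R E]
  [AddCommGroup D] [Module R D]

lemma inj_extend [hE : Module.Injective R E] (S : Submodule R M) (f : S →ₗ[R] E) :
    ∃ g : M →ₗ[R] E, ∀ x : S, g x = f x := by
  obtain ⟨g, hg⟩ := hE.out S.subtype S.subtype_injective f
  exact ⟨g, fun x => hg x⟩

lemma eklof_lift [hE : Module.Injective R E] {ι : Type u} [LinearOrder ι] [WellFoundedLT ι]
    (B : ι → Submodule R M) (hB : Monotone B) (hT : ∀ x, ∃ t, x ∈ B t) (q : E →ₗ[R] D)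
    (hq : ∀ t, ∀ f : B t →ₗ[R] D, (∀ x : B t, (x : M) ∈ (⨆ s, ⨆ (_ : s < t), B s) → f x = 0) →
      ∃ g : B t →ₗ[R] E, (∀ x : B t, (x : M) ∈ (⨆ s, ⨆ (_ : s < t), B s) → g x = 0) ∧ q.comp g = f)
    (f : M →ₗ[R] D) : ∃ g : M →ₗ[R] E, q.comp g = f := by
  let A : ι → Submodule R M := fun t => ⨆ s, ⨆ (_ : s < t), B s
  have hAB : ∀ t, A t ≤ B t := fun t => iSup₂_le fun s hs => hB hs.le
  have hBA : ∀ s t, s < t → B s ≤ A t := fun s t hs => le_iSup₂ (f := fun s (_ : s < t) => B s) s hs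
  let S : Set (M →ₗ.[R] E) := {p | (∀ t, B t ≤ p.domain ∨ p.domain ≤ A t) ∧
    ∀ x : p.domain, q (p x) = f x}
  have hbot : (⊥ : M →ₗ.[R] E) ∈ S := by
    refine ⟨fun t => Or.inr bot_le, fun x => ?_⟩
    have hx : x = 0 := by
      ext; exact (Submodule.mem_bot R).1 x.2
    subst hx
    simp
  obtain ⟨p, -, hp⟩ := zorn_le_nonempty₀ S (by
    intro c hc hch y hy
    have hd : DirectedOn (· ≤ ·) c := hch.directedOn
    refine ⟨LinearPMap.sSup c hd, ⟨?_, ?_⟩, fun z hz => LinearPMap.le_sSup hd hz⟩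
    · intro t
      by_cases h : ∃ z ∈ c, B t ≤ z.domain
      · obtain ⟨z, hz, hzt⟩ := h
        exact Or.inl (hzt.trans (LinearPMap.le_sSup hd hz).1)
      · push Not at h
        right
        change sSup (LinearPMap.domain '' c) ≤ _
        apply sSup_le
        rintro _ ⟨z, hz, rfl⟩
        exact ((hc hz).1 t).resolve_left (h z hz)
    · intro x
      have hne : (LinearPMap.domain '' c).Nonempty := ⟨_, y, hy, rfl⟩
      have hx : (x : M) ∈ sSup (LinearPMap.domain '' c) := x.2
      rw [Submodule.mem_sSup_of_directed hne] at hx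
      · obtain ⟨_, ⟨z, hz, rfl⟩, hxz⟩ := hx
        have := LinearPMap.sSup_apply hd hz ⟨x, hxz⟩
        have h2 := (hc hz).2 ⟨x, hxz⟩
        rw [← this] at h2
        exact h2
      · exact directedOn_image.2 (hd.mono fun {a b} h => h.1)) ⊥ hbot
  have htop : ∀ t, B t ≤ p.domain := by
    by_contra hcon
    push Not at hcon
    obtain ⟨t, ht, hmin⟩ := WellFounded.has_min (wellFounded_lt (α := ι))
      {t | ¬ B t ≤ p.domain} hcon
    have h1 : p.domain ≤ A t := (hp.prop.1 t).resolve_left ht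
    have h2 : A t ≤ p.domain := iSup₂_le fun s hs => by
      by_contra h; exact hmin s h hs
    obtain ⟨G, hG⟩ := inj_extend p.domain p.toFun
    obtain ⟨g, hg0, hg⟩ := hq t ((f - q.comp G).comp (B t).subtype) (by
      intro x hx
      have h3 := hp.prop.2 ⟨x, h2 hx⟩
      have h4 := hG ⟨x, h2 hx⟩
      simp only [LinearMap.coe_comp, Function.comp_apply, Submodule.subtype_apply,
        LinearMap.sub_apply]
      rw [h4, ← h3]; exact sub_self _)
    let p' : M →ₗ.[R] E := ⟨B t, G.comp (B t).subtype + g⟩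
    have hp' : p' ∈ S := by
      constructor
      · intro s
        rcases le_or_gt s t with h | h
        · exact Or.inl (hB h)
        · exact Or.inr (hBA t s h)
      · intro x
        have := LinearMap.congr_fun hg x
        simp only [LinearMap.coe_comp, Function.comp_apply, Submodule.subtype_apply,
          LinearMap.sub_apply] at this
        change q (G x + g x) = f x
        rw [map_add, this]; abel
    have hle : p ≤ p' := by
      refine ⟨h1.trans (hAB t), fun x y hxy => ?_⟩
      change p.toFun x = G y + g y
      rw [hg0 y (by rw [← hxy]; exact h1 x.2), add_zero, ← hG x, hxy]
    exact ht ((hp.2 hp' hle).1)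
  refine ⟨p.toFun.comp (LinearMap.codRestrict p.domain LinearMap.id fun x => ?_), ?_⟩
  · obtain ⟨t, ht⟩ := hT x
    exact htop t ht
  · ext x
    exact hp.prop.2 ⟨x, _⟩

/-- Auslander's lemma. -/
lemma auslander {ι : Type u} [LinearOrder ι] [WellFoundedLT ι]
    (B : ι → Submodule R M) (hB : Monotone B) (hT : ∀ x, ∃ t, x ∈ B t) (m : ℕ)
    (hq : ∀ t, PdLT R (B t ⧸ (⨆ s, ⨆ (_ : s < t), B s).submoduleOf (B t)) (m + 1)) :
    PdLT R M (m + 1) := by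
  apply pdLT_of_ext
  intro N _ _
  obtain ⟨C, _, _, hC⟩ := exists_cosyz R m N
  rw [← hC]
  obtain ⟨E, D, _, _, _, _, i, q, hE, hs⟩ := exists_inj R C
  refine extZ_one_of_lift hs (extZ_injective 0) fun f => ?_
  refine eklof_lift B hB hT q (fun t f hf => ?_) f
  let W := (⨆ s, ⨆ (_ : s < t), B s).submoduleOf (B t)
  have h1 : ExtZ R (B t ⧸ W) C 1 := (hC _).2 (ext_of_pdLT (hq t) le_rfl)
  obtain ⟨b, hb⟩ := lift_of_extZ_one hs h1 (W.liftQ f (fun x hx => hf x hx))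
  refine ⟨b.comp W.mkQ, fun x hx => ?_, ?_⟩
  · have : W.mkQ x = 0 := (Submodule.Quotient.mk_eq_zero _).2 hx
    rw [LinearMap.comp_apply, this, map_zero]
  · ext x
    exact LinearMap.congr_fun hb (W.mkQ x)

end Eklof
end Homol

open TensorProduct
section Flat
variable {R : Type u} [Ring R]

/-- Finitary purity of `span T` in `P`. -/
def VProp (R : Type u) [Ring R] {P : Type u} [AddCommGroup P] [Module R P] (T : Set P) : Prop :=
  ∀ A : Finset P, (A : Set P) ⊆ T → ∃ (φ : P →ₗ[R] P) (B : Finset P), (B : Set P) ⊆ T ∧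
    LinearMap.range φ ≤ Submodule.span R (B : Set P) ∧ ∀ a ∈ A, φ a = a

lemma vprop_of_single {P : Type u} [AddCommGroup P] [Module R P] (K : Submodule R P)
    (h : ∀ k ∈ K, ∃ (φ : P →ₗ[R] P) (B : Finset P), (B : Set P) ⊆ K ∧
    LinearMap.range φ ≤ Submodule.span R (B : Set P) ∧ φ k = k) : VProp R (K : Set P) := by
  classical
  intro A
  induction A using Finset.induction_on with
  | empty => intro _; exact ⟨0, ∅, by simp, by simp, by simp⟩
  | insert k A hk ih =>
    intro hA
    rw [Finset.coe_insert, Set.insert_subset_iff] at hA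
    obtain ⟨φ, B, hB, hφ, hφA⟩ := ih hA.2
    have hBK : Submodule.span R (B : Set P) ≤ K := Submodule.span_le.2 hB
    have hk' : k - φ k ∈ K := K.sub_mem hA.1 (hBK (hφ ⟨k, rfl⟩))
    obtain ⟨ψ, B', hB', hψ, hψA⟩ := h _ hk'
    refine ⟨φ + ψ.comp (LinearMap.id - φ), B ∪ B', ?_, ?_, ?_⟩
    · rw [Finset.coe_union]; exact Set.union_subset hB hB'
    · rintro _ ⟨x, rfl⟩
      rw [Finset.coe_union, Submodule.span_union]
      exact Submodule.add_mem_sup (hφ ⟨x, rfl⟩) (hψ ⟨_, rfl⟩)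
    · intro a ha
      rw [Finset.mem_insert] at ha
      rcases ha with rfl | ha
      · simp only [LinearMap.add_apply, LinearMap.comp_apply, LinearMap.sub_apply,
          LinearMap.id_apply]
        rw [hψA]; abel
      · simp [hφA a ha]

lemma flat_mem {F X : Type u} [AddCommGroup F] [Module R F] (hF : ModFlat R F)
    (p : (X →₀ R) →ₗ[R] F) (hp : Function.Surjective p) (k : X →₀ R) (hk : p k = 0)
    (I : Submodule Rᵐᵒᵖ R) (hI : ∀ x, k x ∈ I) :
    k ∈ AddSubgroup.closure {z : X →₀ R | ∃ a ∈ I, ∃ k', p k' = 0 ∧ z = a • k'} := by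
  classical
  set IK := AddSubgroup.closure {z : X →₀ R | ∃ a ∈ I, ∃ k', p k' = 0 ∧ z = a • k'} with hIK
  let σ : F → (X →₀ R) := Function.surjInv hp
  have hσ : ∀ f, p (σ f) = f := Function.surjInv_eq hp
  obtain ⟨Q, _, mk, hmk⟩ : ∃ (Q : Type u) (_ : AddCommGroup Q) (mk : (X →₀ R) →+ Q),
      ∀ z, mk z = 0 ↔ z ∈ IK :=
    ⟨(X →₀ R) ⧸ IK, QuotientAddGroup.Quotient.addCommGroup IK, QuotientAddGroup.mk' IK,
      fun z => QuotientAddGroup.eq_zero_iff z⟩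
  have key : ∀ a ∈ I, ∀ u v, p u = p v → mk (a • u) = mk (a • v) := by
    intro a ha u v huv
    rw [← sub_eq_zero, ← map_sub, ← smul_sub]
    refine (hmk _).2 (AddSubgroup.subset_closure ?_)
    exact ⟨a, ha, u - v, by rw [map_sub, huv, sub_self], rfl⟩
  let b : I →+ F →+ Q := AddMonoidHom.mk' (fun a =>
      AddMonoidHom.mk' (fun f => mk (a.1 • σ f)) (by
        intro f g
        rw [← map_add, ← smul_add]
        exact key _ a.2 _ _ (by simp [hσ]))) (by
      intro a a'
      ext f
      simp [add_smul])
  have hb : ∀ (a : I) (u : X →₀ R), b a (p u) = mk (a.1 • u) := fun a u =>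
    key _ a.2 _ _ (hσ _)
  let β0 : TensorProduct ℤ I F →+ Q := TensorProduct.liftAddHom b (by
    intro r m n
    rw [map_zsmul, map_zsmul, AddMonoidHom.zsmul_apply])
  let β : bTensor R I F →+ Q := QuotientAddGroup.lift _ β0 (by
    change tensorRel R I F ≤ β0.ker
    rw [tensorRel, AddSubgroup.closure_le]
    rintro _ ⟨r, n, f, rfl⟩
    obtain ⟨u, rfl⟩ := hp f
    change β0 _ = 0
    rw [map_sub, sub_eq_zero]
    change b _ _ = b _ _
    rw [← map_smul, hb, hb, smul_smul]
    rfl)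
  let e : X → F := fun x => p (Finsupp.single x 1)
  let z : bTensor R I F := ∑ x ∈ k.support,
    QuotientAddGroup.mk' (tensorRel R I F) ((⟨k x, hI x⟩ : I) ⊗ₜ[ℤ] e x)
  have hz : tmapLeft R F I.subtype z = 0 := by
    have h1 : ∀ x, tmapLeft R F I.subtype
        (QuotientAddGroup.mk' (tensorRel R I F) ((⟨k x, hI x⟩ : I) ⊗ₜ[ℤ] e x)) =
        QuotientAddGroup.mk' (tensorRel R R F) ((1 : R) ⊗ₜ[ℤ] (k x • e x)) := by
      intro x
      change QuotientAddGroup.mk' (tensorRel R R F) ((k x : R) ⊗ₜ[ℤ] e x) = _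
      rw [← sub_eq_zero, ← map_sub]
      refine (QuotientAddGroup.eq_zero_iff _).2 (AddSubgroup.subset_closure ?_)
      exact ⟨k x, 1, e x, by simp⟩
    rw [map_sum, Finset.sum_congr rfl fun x _ => h1 x, ← map_sum, ← TensorProduct.tmul_sum]
    have : ∑ x ∈ k.support, k x • e x = p k := by
      conv_rhs => rw [← Finsupp.sum_single k]
      rw [Finsupp.sum, map_sum]
      refine Finset.sum_congr rfl fun x _ => ?_
      rw [← map_smul]; simp
    rw [this, hk]; simp
  have hz0 : z = 0 := hF I R _ _ _ _ I.subtype I.subtype_injective (by rw [hz, map_zero])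
  have h2 : β z = mk k := by
    rw [map_sum]
    conv_rhs => rw [← Finsupp.sum_single k]
    rw [Finsupp.sum, map_sum]
    refine Finset.sum_congr rfl fun x _ => ?_
    change b _ (p _) = _
    rw [hb]; simp
  rw [hz0, map_zero] at h2
  exact (hmk _).1 h2.symm

lemma flat_vprop {F X : Type u} [AddCommGroup F] [Module R F] (hF : ModFlat R F)
    (p : (X →₀ R) →ₗ[R] F) (hp : Function.Surjective p) :
    VProp R (LinearMap.ker p : Set (X →₀ R)) := by
  classical
  apply vprop_of_single
  intro k hk
  have hI : ∀ x, k x ∈ Submodule.span Rᵐᵒᵖ (k '' k.support) := by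
    intro x
    by_cases hx : x ∈ k.support
    · exact Submodule.subset_span ⟨x, hx, rfl⟩
    · rw [Finsupp.notMem_support_iff.1 hx]; exact Submodule.zero_mem _
  have hspan : ∀ a ∈ Submodule.span Rᵐᵒᵖ (k '' k.support),
      ∃ r : X → R, a = ∑ x ∈ k.support, k x * r x := by
    intro a ha
    induction ha using Submodule.span_induction with
    | mem a ha =>
      obtain ⟨x, hx, rfl⟩ := ha
      refine ⟨fun y => if y = x then 1 else 0, ?_⟩
      simp only [mul_ite, mul_one, mul_zero, Finset.sum_ite_eq', Finset.mem_coe.1 hx, if_true]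
    | zero => exact ⟨0, by simp⟩
    | add a b _ _ iha ihb =>
      obtain ⟨r, rfl⟩ := iha
      obtain ⟨s, rfl⟩ := ihb
      exact ⟨r + s, by simp [mul_add, Finset.sum_add_distrib]⟩
    | smul c a _ ih =>
      obtain ⟨r, rfl⟩ := ih
      refine ⟨fun x => r x * c.unop, ?_⟩
      rw [MulOpposite.smul_eq_mul_unop, Finset.sum_mul]
      simp [mul_assoc]
  have hmem := flat_mem hF p hp k hk _ hI
  have hw : ∀ z ∈ AddSubgroup.closure {z : X →₀ R | ∃ a ∈ Submodule.span Rᵐᵒᵖ (k '' k.support),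
      ∃ k', p k' = 0 ∧ z = a • k'},
      ∃ w : X → (X →₀ R), (∀ x, p (w x) = 0) ∧ z = ∑ x ∈ k.support, k x • w x := by
    intro z hz
    induction hz using AddSubgroup.closure_induction with
    | mem z hz =>
      obtain ⟨a, ha, k', hk', rfl⟩ := hz
      obtain ⟨r, rfl⟩ := hspan a ha
      refine ⟨fun x => r x • k', fun x => by simp [hk'], ?_⟩
      rw [Finset.sum_smul]
      simp [smul_smul]
    | zero => exact ⟨0, by simp, by simp⟩
    | add a b _ _ iha ihb =>
      obtain ⟨r, hr, rfl⟩ := iha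
      obtain ⟨s, hs, rfl⟩ := ihb
      exact ⟨r + s, by simp [hr, hs], by simp [Finset.sum_add_distrib]⟩
    | neg a _ ih =>
      obtain ⟨r, hr, rfl⟩ := ih
      exact ⟨-r, by simp [hr], by simp⟩
  obtain ⟨w, hw0, hwk⟩ := hw k hmem
  refine ⟨Finsupp.linearCombination R (fun x => if x ∈ k.support then w x else 0),
    k.support.image w, ?_, ?_, ?_⟩
  · intro y hy
    simp only [Finset.coe_image, Set.mem_image] at hy
    obtain ⟨x, -, rfl⟩ := hy
    exact hw0 x
  · rw [Finsupp.range_linearCombination, Submodule.span_le]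
    rintro _ ⟨x, rfl⟩
    by_cases hx : x ∈ k.support
    · simp only [hx, if_true]
      exact Submodule.subset_span (Finset.mem_coe.2 (Finset.mem_image_of_mem _ hx))
    · simp only [hx, if_false]; exact Submodule.zero_mem _
  · rw [Finsupp.linearCombination_apply, Finsupp.sum]
    conv_rhs => rw [hwk]
    refine Finset.sum_congr rfl fun x hx => ?_
    simp only [hx, if_true]

lemma vprop_countable {P : Type u} [AddCommGroup P] [Module R P] [Module.Projective R P]
    (T : Set P) (hT : VProp R T) (hc : T.Countable) :
    Module.Projective R (Submodule.span R T) := by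
  classical
  rcases T.eq_empty_or_nonempty with rfl | hne
  · rw [Submodule.span_empty]; infer_instance
  obtain ⟨t, rfl⟩ := hc.exists_eq_range hne
  set T := Set.range t
  set K := Submodule.span R T with hK
  choose φ B hB hφ hφA using hT
  let st : {A : Finset P // (A : Set P) ⊆ T} → ℕ → {A : Finset P // (A : Set P) ⊆ T} :=
    fun A n => ⟨A.1 ∪ B A.1 A.2 ∪ {t n}, by
      have h1 := A.2
      have h2 := hB A.1 A.2
      have h3 : t n ∈ T := ⟨n, rfl⟩
      rw [Finset.coe_union, Finset.coe_union, Finset.coe_singleton]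
      exact Set.union_subset (Set.union_subset h1 h2) (Set.singleton_subset_iff.2 h3)⟩
  let A : ℕ → {A : Finset P // (A : Set P) ⊆ T} := fun n => Nat.rec ⟨∅, by simp⟩ (fun n a => st a n) n
  have hAs : ∀ n, (A (n + 1)).1 = (A n).1 ∪ B (A n).1 (A n).2 ∪ {t n} := fun n => rfl
  let Ψ : ℕ → (P →ₗ[R] P) := fun n => Nat.casesOn n 0 (fun n => φ (A n).1 (A n).2)
  have hAmono : Monotone fun n => (A n).1 := monotone_nat_of_le_succ fun n => by
    rw [hAs, Finset.union_assoc]; exact Finset.subset_union_left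
  have hcomp : ∀ n x, Ψ (n + 1) (Ψ n x) = Ψ n x := by
    intro n x
    cases n with
    | zero => change Ψ 1 0 = 0; simp
    | succ n =>
      have h1 : Ψ (n + 1) x ∈ Submodule.span R (B (A n).1 (A n).2 : Set P) := hφ _ _ ⟨x, rfl⟩
      have h2 : Submodule.span R (B (A n).1 (A n).2 : Set P) ≤
          LinearMap.eqLocus (Ψ (n + 1 + 1)) LinearMap.id := by
        rw [Submodule.span_le]
        intro y hy
        refine hφA (A (n + 1)).1 (A (n + 1)).2 y ?_
        rw [hAs]
        simp only [Finset.mem_union]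
        exact Or.inl (Or.inr hy)
      exact h2 h1
  have hΨK : ∀ n x, Ψ n x ∈ K := by
    intro n x
    cases n with
    | zero => exact K.zero_mem
    | succ n => exact Submodule.span_mono (hB _ _) (hφ (A n).1 (A n).2 ⟨x, rfl⟩)
  have hev : ∀ k ∈ K, ∃ N, ∀ n ≥ N, Ψ n k = k := by
    intro k hk
    induction hk using Submodule.span_induction with
    | mem k hk =>
      obtain ⟨i, rfl⟩ := hk
      refine ⟨i + 2, fun n hn => ?_⟩
      obtain ⟨n, rfl⟩ : ∃ n', n = n' + 1 := ⟨n - 1, by omega⟩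
      refine hφA (A n).1 (A n).2 _ ?_
      refine hAmono (show i + 1 ≤ n by omega) ?_
      simp [hAs]
    | zero => exact ⟨0, by simp⟩
    | add a b _ _ ha hb =>
      obtain ⟨N, hN⟩ := ha
      obtain ⟨N', hN'⟩ := hb
      refine ⟨max N N', fun n hn => ?_⟩
      rw [map_add, hN n (le_of_max_le_left hn), hN' n (le_of_max_le_right hn)]
    | smul c a _ ha =>
      obtain ⟨N, hN⟩ := ha
      exact ⟨N, fun n hn => by rw [map_smul, hN n hn]⟩
  have hfin : ∀ k : K, (Function.support fun n => k.1 - Ψ n k.1).Finite := by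
    intro k
    obtain ⟨N, hN⟩ := hev k.1 k.2
    refine (Set.finite_lt_nat N).subset fun n hn => ?_
    by_contra h
    exact hn (by simp only [hN n (not_lt.1 h), sub_self])
  let s : K →ₗ[R] (ℕ →₀ P) :=
    { toFun := fun k => Finsupp.ofSupportFinite _ (hfin k)
      map_add' := by
        intro a b; ext n
        simp only [Finsupp.ofSupportFinite_coe, Finsupp.add_apply, Submodule.coe_add, map_add]
        abel
      map_smul' := by
        intro a b; ext n
        simp only [Finsupp.ofSupportFinite_coe, Finsupp.smul_apply, Submodule.coe_smul, map_smul,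
          smul_sub, RingHom.id_apply] }
  let τ : (ℕ →₀ P) →ₗ[R] K := Finsupp.lsum ℕ fun n => (Ψ (n + 1)).codRestrict K (hΨK (n + 1))
  have : Module.Projective R (ℕ →₀ P) :=
    Module.Projective.of_equiv (finsuppLequivDFinsupp (ι := ℕ) (M := P) R).symm
  refine Module.Projective.of_split s τ ?_
  ext k
  obtain ⟨N, hN⟩ := hev k.1 k.2
  have hsub : (s k).support ⊆ Finset.range N := by
    intro n hn
    rw [Finsupp.mem_support_iff] at hn
    rw [Finset.mem_range]
    by_contra h
    exact hn (by
      change k.1 - Ψ n k.1 = 0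
      simp only [hN n (not_lt.1 h), sub_self])
  change K.subtype (Finsupp.sum (s k) fun n y => (Ψ (n + 1)).codRestrict K (hΨK (n + 1)) y) = k.1
  rw [Finsupp.sum_of_support_subset _ hsub _ (by simp), map_sum]
  have : ∀ n, K.subtype ((Ψ (n + 1)).codRestrict K (hΨK (n + 1)) (s k n)) = Ψ (n + 1) k.1 - Ψ n k.1 := by
    intro n
    change Ψ (n + 1) (k.1 - Ψ n k.1) = _
    rw [map_sub, hcomp]
  rw [Finset.sum_congr rfl fun n _ => this n, Finset.sum_range_sub (fun n => Ψ n k.1), hN N le_rfl]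
  change k.1 - 0 = k.1
  rw [sub_zero]

end Flat
section Jensen
variable {R : Type u} [Ring R]

section cl
variable {P : Type u} (c : Finset P → Finset P)

/-- One closing-off step. -/
def clStep (S : Set P) : Set P := S ∪ ⋃ A : Finset S, (c (A.map ⟨Subtype.val, Subtype.val_injective⟩) : Set P)

/-- Closure under `c`. -/
def clc (S : Set P) : Set P := ⋃ n : ℕ, (clStep c)^[n] S

lemma subset_clStep (S : Set P) : S ⊆ clStep c S := Set.subset_union_left

lemma mem_clStep {S : Set P} {A : Finset P} (hA : (A : Set P) ⊆ S) : (c A : Set P) ⊆ clStep c S := by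
  classical
  have : (A.subtype (· ∈ S)).map ⟨Subtype.val, Subtype.val_injective⟩ = A := by
    ext x
    simp only [Finset.mem_map, Finset.mem_subtype, Function.Embedding.coeFn_mk, Subtype.exists,
      exists_and_left, exists_prop, exists_eq_right_right, and_iff_left_iff_imp]
    exact fun h => hA h
  intro x hx
  refine Or.inr (Set.mem_iUnion.2 ⟨A.subtype (· ∈ S), ?_⟩)
  rw [this]; exact hx

lemma clStep_subset {S T : Set P} (hST : S ⊆ T)
    (hT : ∀ A : Finset P, (A : Set P) ⊆ T → (c A : Set P) ⊆ T) : clStep c S ⊆ T := by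
  refine Set.union_subset hST (Set.iUnion_subset fun A => hT _ ?_)
  intro x hx
  simp only [Finset.coe_map, Function.Embedding.coeFn_mk, Set.mem_image] at hx
  obtain ⟨y, -, rfl⟩ := hx
  exact hST y.2

lemma clc_subset {S T : Set P} (hST : S ⊆ T)
    (hT : ∀ A : Finset P, (A : Set P) ⊆ T → (c A : Set P) ⊆ T) : clc c S ⊆ T := by
  refine Set.iUnion_subset fun n => ?_
  induction n with
  | zero => exact hST
  | succ n ih => rw [Function.iterate_succ_apply']; exact clStep_subset c ih hT

lemma subset_clc (S : Set P) : S ⊆ clc c S := Set.subset_iUnion (fun n => (clStep c)^[n] S) 0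

lemma clc_closed (S : Set P) (A : Finset P) (hA : (A : Set P) ⊆ clc c S) :
    (c A : Set P) ⊆ clc c S := by
  have hm : Monotone fun n => (clStep c)^[n] S := monotone_nat_of_le_succ fun n => by
    rw [Function.iterate_succ_apply']; exact subset_clStep c _
  obtain ⟨n, hn⟩ := Directed.exists_mem_subset_of_finset_subset_biUnion (hm.directed_le) hA
  refine (mem_clStep c hn).trans ?_
  have := Set.subset_iUnion (fun n => (clStep c)^[n] S) (n + 1)
  rw [Function.iterate_succ_apply'] at this
  exact this

lemma clc_mono {S T : Set P} (h : S ⊆ T) : clc c S ⊆ clc c T :=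
  clc_subset c (h.trans (subset_clc c T)) (clc_closed c T)

open Cardinal in
lemma clStep_card {S : Set P} {κ : Cardinal.{u}} (hκ : ℵ₀ ≤ κ) (hS : #S ≤ κ) :
    #(clStep c S) ≤ κ := by
  classical
  refine (mk_union_le _ _).trans (add_le_of_le hκ hS ((mk_iUnion_le _).trans
    (mul_le_of_le hκ ?_ ?_)))
  · have : Function.Injective (Finset.toList : Finset S → List S) := by
      intro a b hab
      rw [← Finset.toList_toFinset a, hab, Finset.toList_toFinset]
    exact (mk_le_of_injective this).trans ((mk_list_le_max _).trans (max_le hκ hS))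
  · refine ciSup_le' fun A => ?_
    exact (lt_aleph0_of_finite _).le.trans hκ

open Cardinal in
lemma clc_card {S : Set P} {κ : Cardinal.{u}} (hκ : ℵ₀ ≤ κ) (hS : #S ≤ κ) :
    #(clc c S) ≤ κ := by
  have h := mk_iUnion_le_lift (fun n : ℕ => (clStep c)^[n] S)
  rw [lift_uzero] at h
  refine h.trans (mul_le_of_le hκ (by simpa using hκ) ?_)
  refine ciSup_le' fun n => ?_
  rw [lift_uzero]
  induction n with
  | zero => exact hS
  | succ n ih => rw [Function.iterate_succ_apply']; exact clStep_card c hκ ih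

end cl

open Cardinal in
lemma jensen_span {m : ℕ} (H : ∀ (M : Type u) [AddCommGroup M] [Module R M] (k : ℕ),
    PdLT R M k → PdLT R M (m + 1)) {P : Type u} [AddCommGroup P] [Module R P]
    [Module.Projective R P] (κ : Cardinal.{u}) : ∀ T : Set P, #T = κ → VProp R T →
      PdLT R (Submodule.span R T) (m + 1) := by
  classical
  induction κ using Cardinal.lt_wf.induction with
  | _ κ ih =>
  intro T hTκ hT
  by_cases hc : T.Countable
  · exact pdLT_mono (pdLT_one_iff.2 (vprop_countable T hT hc)) (by omega)
  have hκ : ℵ₀ < κ := by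
    rw [← hTκ]
    rw [← not_le, le_aleph0_iff_set_countable]; exact hc
  choose φ B hB hφ hφA using hT
  let c : Finset P → Finset P := fun A => if h : (A : Set P) ⊆ T then B A h else ∅
  have hcT : ∀ A : Finset P, (A : Set P) ⊆ T → (c A : Set P) ⊆ T := by
    intro A hA
    simp only [c, hA, dif_pos]; exact hB _ _
  obtain ⟨e⟩ : Nonempty (κ.ord.ToType ≃ T) := by
    rw [← Cardinal.eq, mk_ord_toType, hTκ]
  let C : κ.ord.ToType → Set P := fun t => clc c ((fun i => (e i : P)) '' Set.Iio t)
  have hCT : ∀ t, C t ⊆ T := fun t => clc_subset c (by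
    rintro _ ⟨i, -, rfl⟩; exact (e i).2) hcT
  have hCm : Monotone C := fun s t hst => clc_mono c
    (Set.image_mono (Set.Iio_subset_Iio hst))
  have hCc : ∀ t, #(C t) < κ := by
    intro t
    refine (clc_card c (le_max_right #(Set.Iio t) ℵ₀)
      (mk_image_le.trans (le_max_left _ _))).trans_lt (max_lt (mk_Iio_toType_ord_lt t) hκ)
  have hV : ∀ S ⊆ T, (∀ A : Finset P, A.Nonempty → (A : Set P) ⊆ S → (c A : Set P) ⊆ S) →
      VProp R S := by
    intro S hS hcl A hA
    rcases A.eq_empty_or_nonempty with rfl | hne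
    · exact ⟨0, ∅, by simp, by simp, by simp⟩
    have hAT := hA.trans hS
    have := hcl A hne hA
    simp only [c, hAT, dif_pos] at this
    exact ⟨φ A hAT, B A hAT, this, hφ _ _, hφA _ _⟩
  have hVC : ∀ t, VProp R (C t) := fun t => hV _ (hCT t) fun A _ hA => clc_closed c _ A hA
  let U : κ.ord.ToType → Set P := fun t => ⋃ s : Set.Iio t, C s
  have hUC : ∀ t, U t ⊆ C t := fun t => Set.iUnion_subset fun s => hCm (le_of_lt s.2)
  have hVU : ∀ t, VProp R (U t) := fun t => hV _ ((hUC t).trans (hCT t)) fun A hne hA => by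
    obtain ⟨a, ha⟩ := hne
    obtain ⟨s, hs⟩ := Set.mem_iUnion.1 (hA ha)
    have : Nonempty (Set.Iio t) := ⟨s⟩
    have hd : Monotone fun s : Set.Iio t => C s := fun a b hab => hCm hab
    obtain ⟨s, hs⟩ := Directed.exists_mem_subset_of_finset_subset_biUnion hd.directed_le hA
    exact (clc_closed c _ A hs).trans (Set.subset_iUnion (fun s : Set.Iio t => C s) s)
  have hpC : ∀ t, PdLT R (Submodule.span R (C t)) (m + 1) := fun t => ih _ (hCc t) _ rfl (hVC t)
  have hpU : ∀ t, PdLT R (Submodule.span R (U t)) (m + 1) := fun t =>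
    ih _ ((mk_le_mk_of_subset (hUC t)).trans_lt (hCc t)) _ rfl (hVU t)
  have hno : NoMaxOrder κ.ord.ToType := Cardinal.noMaxOrder hκ.le
  have hsp : ∀ t, Submodule.span R (C t) ≤ Submodule.span R T := fun t =>
    Submodule.span_mono (hCT t)
  let Bm : κ.ord.ToType → Submodule R (Submodule.span R T) := fun t =>
    (Submodule.span R (C t)).comap (Submodule.span R T).subtype
  have hBm : Monotone Bm := fun s t hst => Submodule.comap_mono (Submodule.span_mono (hCm hst))
  refine auslander Bm hBm ?_ m ?_
  · have hne : Nonempty κ.ord.ToType := by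
      rw [← mk_ne_zero_iff, mk_ord_toType]
      exact (aleph0_pos.trans hκ).ne'
    have hd : Monotone fun t => Submodule.span R (C t) := fun s t hst =>
      Submodule.span_mono (hCm hst)
    have hle : Submodule.span R T ≤ ⨆ t, Submodule.span R (C t) := by
      rw [Submodule.span_le]
      intro x hx
      obtain ⟨i, hi⟩ := e.surjective ⟨x, hx⟩
      obtain ⟨t, ht⟩ := exists_gt i
      refine Submodule.mem_iSup_of_mem t (Submodule.subset_span (subset_clc c _ ?_))
      exact ⟨i, ht, by simp [hi]⟩
    intro x
    obtain ⟨t, ht⟩ := (Submodule.mem_iSup_of_directed _ hd.directed_le).1 (hle x.2)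
    exact ⟨t, ht⟩
  · intro t
    have hWB : (⨆ s, ⨆ (_ : s < t), Bm s) ≤ Bm t := iSup₂_le fun s hs => hBm hs.le
    have hmap : (⨆ s, ⨆ (_ : s < t), Bm s).map (Submodule.span R T).subtype =
        Submodule.span R (U t) := by
      simp only [Submodule.map_iSup, Bm, Submodule.map_comap_subtype]
      rw [Submodule.span_iUnion, iSup_subtype']
      refine iSup_congr fun s => ?_
      exact inf_eq_right.2 (hsp _)
    have hW : PdLT R ((⨆ s, ⨆ (_ : s < t), Bm s).submoduleOf (Bm t)) (m + 1) := by
      refine pdLT_equiv (Submodule.submoduleOfEquivOfLe hWB).symm ?_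
      refine pdLT_equiv (Submodule.equivMapOfInjective (Submodule.span R T).subtype
        (Submodule.subtype_injective _) _).symm ?_
      rw [hmap]
      exact hpU t
    have hB' : PdLT R (Bm t) (m + 1) :=
      pdLT_equiv (Submodule.comapSubtypeEquivOfLe (hsp t)).symm (hpC t)
    exact H _ (m + 1 + 1) (pdLT_right (ses_quot _) hW (pdLT_mono hB' (by omega)))

lemma jensen {m : ℕ} (H : ∀ (M : Type u) [AddCommGroup M] [Module R M] (k : ℕ),
    PdLT R M k → PdLT R M (m + 1)) {F : Type u} [AddCommGroup F] [Module R F]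
    (hF : ModFlat R F) : PdLT R F (m + 1) := by
  let p : (F →₀ R) →ₗ[R] F := Finsupp.linearCombination R id
  have hp : Function.Surjective p := fun x => ⟨Finsupp.single x 1, by simp [p]⟩
  have h1 := jensen_span H _ _ rfl (flat_vprop hF p hp)
  rw [Submodule.span_eq] at h1
  exact H _ (m + 1 + 1) (pdLT_right (ses_ker p hp) h1
    (pdLT_mono (pdLT_one_iff.2 inferInstance) (by omega)))

end Jensen
section Trans
variable {R : Type u} [Ring R]
variable {𝒢 : ∀ (N : Type u) [AddCommGroup N] [Module R N], Prop}
variable {M : Type u} [AddCommGroup M] [Module R M]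

lemma res_zero (h : HasLeftResolutionLE R 𝒢 M 0) :
    ∃ (G : Type u) (_ : AddCommGroup G) (_ : Module R G), 𝒢 G ∧ Nonempty (G ≃ₗ[R] M) := by
  obtain ⟨G, _, _, d, π, hG, hs, hπ, he, -⟩ := h
  refine ⟨G 0, _, _, hG 0, ⟨LinearEquiv.ofBijective π ⟨?_, hπ⟩⟩⟩
  rw [injective_iff_map_eq_zero]
  intro x hx
  obtain ⟨y, rfl⟩ := (he x).1 hx
  have := hs (0 + 1) (by omega)
  rw [Subsingleton.elim y 0, map_zero]

lemma res_succ {n : ℕ} (h : HasLeftResolutionLE R 𝒢 M (n + 1)) :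
    ∃ (K G : Type u) (_ : AddCommGroup K) (_ : Module R K) (_ : AddCommGroup G) (_ : Module R G)
      (f : K →ₗ[R] G) (g : G →ₗ[R] M), IsSES R f g ∧ 𝒢 G ∧ HasLeftResolutionLE R 𝒢 K n := by
  obtain ⟨G, _, _, d, π, hG, hs, hπ, he, hd⟩ := h
  refine ⟨LinearMap.ker π, G 0, _, _, _, _, (LinearMap.ker π).subtype, π, ses_ker π hπ, hG 0,
    fun i => G (i + 1), fun i => inferInstance, fun i => inferInstance, fun i => d (i + 1),
    (d 0).codRestrict _ (fun x => (he _).2 ⟨x, rfl⟩), fun i => hG _, fun i hi => hs _ (by omega),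
    ?_, ?_, fun i => hd _⟩
  · rintro ⟨x, hx⟩
    obtain ⟨y, rfl⟩ := (he x).1 hx
    exact ⟨y, rfl⟩
  · intro x
    rw [← hd 0 x, Subtype.ext_iff]
    rfl

lemma res_base (h : 𝒢 M) (h0 : 𝒢 PUnit) : HasLeftResolutionLE R 𝒢 M 0 := by
  let G : ℕ → ModuleCat.{u} R := fun i => match i with
    | 0 => ModuleCat.of R M
    | _ + 1 => ModuleCat.of R PUnit
  refine ⟨fun i => G i, fun i => inferInstance, fun i => inferInstance, fun i => 0,
    LinearMap.id, ?_, ?_, Function.surjective_id, ?_, ?_⟩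
  · rintro (_ | i)
    · exact h
    · exact h0
  · rintro (_ | i) hi
    · omega
    · exact inferInstanceAs (Subsingleton PUnit)
  · intro x
    constructor
    · intro hx; exact ⟨0, hx.symm⟩
    · rintro ⟨y, rfl⟩; rfl
  · intro i x
    constructor
    · intro _; exact ⟨0, (show (0 : PUnit.{u + 1}) = x from rfl)⟩
    · intro _; rfl

lemma res_cons {n : ℕ} {K G : Type u} [AddCommGroup K] [Module R K] [AddCommGroup G] [Module R G]
    {f : K →ₗ[R] G} {g : G →ₗ[R] M} (h : IsSES R f g) (hG : 𝒢 G)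
    (hK : HasLeftResolutionLE R 𝒢 K n) : HasLeftResolutionLE R 𝒢 M (n + 1) := by
  obtain ⟨G', _, _, d, π, hG', hs, hπ, he, hd⟩ := hK
  let X : ℕ → ModuleCat.{u} R := fun i => match i with
    | 0 => ModuleCat.of R G
    | i + 1 => ModuleCat.of R (G' i)
  let D : ∀ i, X (i + 1) →ₗ[R] X i := fun i => match i with
    | 0 => f.comp π
    | i + 1 => d i
  refine ⟨fun i => X i, fun i => inferInstance, fun i => inferInstance, D, g, ?_, ?_, h.2.2, ?_, ?_⟩
  · rintro (_ | i)
    · exact hG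
    · exact hG' i
  · rintro (_ | i) hi
    · omega
    · exact hs i (by omega)
  · intro x
    rw [h.2.1 x]
    constructor
    · rintro ⟨y, rfl⟩
      obtain ⟨z, rfl⟩ := hπ y
      exact ⟨z, rfl⟩
    · rintro ⟨z, rfl⟩; exact ⟨π z, rfl⟩
  · rintro (_ | i)
    · intro x
      refine Iff.trans ?_ (he x)
      change f (π x) = 0 ↔ π x = 0
      exact map_eq_zero_iff f h.1
    · exact hd i

lemma res_proj_iff (n : ℕ) : ∀ (M : Type u) [AddCommGroup M] [Module R M],
    HasLeftResolutionLE R (fun N _ _ => Module.Projective R N) M n ↔ PdLT R M (n + 1) := by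
  induction n with
  | zero =>
    intro M _ _
    rw [zero_add, pdLT_one_iff]
    constructor
    · intro h
      obtain ⟨G, _, _, hG, ⟨e⟩⟩ := res_zero h
      have : Module.Projective R G := hG
      exact Module.Projective.of_equiv e
    · intro h
      refine res_base (𝒢 := fun N _ _ => Module.Projective R N) h ?_
      infer_instance
  | succ n ih =>
    intro M _ _
    constructor
    · intro h
      obtain ⟨K, G, _, _, _, _, f, g, hs, hG, hK⟩ := res_succ h
      exact pdLT_right hs ((ih K).1 hK) (pdLT_mono (pdLT_one_iff.2 hG) (by omega))
    · intro h
      let p : (M →₀ R) →ₗ[R] M := Finsupp.linearCombination R id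
      have hp : Function.Surjective p := fun x => ⟨Finsupp.single x 1, by simp [p]⟩
      refine res_cons (𝒢 := fun N _ _ => Module.Projective R N) (ses_ker p hp) inferInstance
        ((ih _).2 (pdLT_left (ses_ker p hp) (pdLT_mono (pdLT_one_iff.2 inferInstance) ?_) h))
      omega

/-- Values of the dimension functions. -/
lemma dim_spec {s : Set ℕ} {d : ℕ∞} (hd : d = sInf ((↑) '' s)) (h : d ≠ ⊤) :
    ∃ n ∈ s, d = (n : ℕ∞) := by
  have hne : ((fun n : ℕ => (n : ℕ∞)) '' s).Nonempty := by
    by_contra hc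
    rw [Set.not_nonempty_iff_eq_empty] at hc
    rw [hc, sInf_empty] at hd
    exact h hd
  obtain ⟨n, hn, hn'⟩ := csInf_mem hne
  exact ⟨n, hn, by rw [hd]; exact hn'.symm⟩

lemma pDim_le {n : ℕ} (h : PdLT R M (n + 1)) : pDim R M ≤ n :=
  sInf_le ⟨n, (res_proj_iff n M).2 h, rfl⟩

lemma pdLT_of_pDim {n : ℕ} (h : pDim R M ≤ n) : PdLT R M (n + 1) := by
  obtain ⟨k, hk, hk'⟩ := dim_spec (d := pDim R M) rfl (ne_top_of_le_ne_top (by simp) h)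
  rw [hk'] at h
  exact pdLT_mono ((res_proj_iff k M).1 hk) (by simpa using h)

end Trans

section GP
variable {R : Type u} [Ring R]

lemma gp_of_proj {M : Type u} [AddCommGroup M] [Module R M] (h : Module.Projective R M) :
    GorensteinProjective R M := by
  let D : M × M →ₗ[R] M × M := (LinearMap.inl R M M).comp (LinearMap.snd R M M)
  refine ⟨fun _ => M × M, fun _ => inferInstance, fun _ => inferInstance, fun _ => D, ?_, ?_, ?_, ?_⟩
  · intro _
    infer_instance
  · rintro _ ⟨x, y⟩
    simp only [D, LinearMap.comp_apply, LinearMap.snd_apply, LinearMap.inl_apply, Set.mem_range,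
      Prod.mk.injEq, Prod.exists, Prod.mk_eq_zero, and_true]
    constructor
    · rintro rfl; exact ⟨0, x, rfl, rfl⟩
    · rintro ⟨a, b, rfl, rfl⟩; rfl
  · refine ⟨LinearEquiv.ofBijective ((LinearMap.inl R M M).codRestrict (LinearMap.ker D) ?_) ⟨?_, ?_⟩⟩
    · intro x; simp [D]
    · intro x y hxy
      have := congrArg (fun z : LinearMap.ker D => z.1.1) hxy
      exact this
    · rintro ⟨⟨x, y⟩, hxy⟩
      have hy : y = 0 := by simpa [D] using hxy
      subst hy
      exact ⟨x, rfl⟩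
  · intro Q _ _ _ _ g
    constructor
    · intro hg
      have hg' : ∀ x, g (x, 0) = 0 := fun x => by
        have := LinearMap.congr_fun hg (0, x)
        simpa [D] using this
      refine ⟨g.comp ((LinearMap.inr R M M).comp (LinearMap.fst R M M)), ?_⟩
      ext x
      · simp [D, hg']
      · simp [D]
    · rintro ⟨a, rfl⟩
      ext x
      · simp [D]; exact map_zero a
      · simp [D]; exact map_zero a

lemma gp_ext {G : Type u} [AddCommGroup G] [Module R G] (h : GorensteinProjective R G)
    (Q : Type u) [AddCommGroup Q] [Module R Q] (hQ : Module.Projective R Q) (n : ℕ) :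
    ExtZ R G Q (n + 1) := by
  obtain ⟨P, _, _, d, hP, he, ⟨e⟩, hH⟩ := h
  refine extZ_equiv e.symm ?_
  have ses : ∀ j, IsSES R (LinearMap.ker (d j)).subtype
      ((d j).codRestrict (LinearMap.ker (d (j + 1))) fun x => (he j _).2 ⟨x, rfl⟩) := by
    intro j
    refine ⟨Submodule.subtype_injective _, ?_, ?_⟩
    · intro x
      rw [Submodule.coe_subtype, Subtype.range_coe, Subtype.ext_iff]
      rfl
    · rintro ⟨x, hx⟩
      obtain ⟨y, rfl⟩ := (he j x).1 hx
      exact ⟨y, rfl⟩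
  have main : ∀ n i, ExtZ R (LinearMap.ker (d (i + 1 + 1 + 1))) Q (n + 1) := by
    intro n
    induction n with
    | zero =>
      intro i
      refine extZ_contra_one (ses (i + 1 + 1)) ?_ (extZ_projective 0)
      intro a
      have s1 := ses (i + 1)
      let q := ((d (i + 1)).codRestrict (LinearMap.ker (d (i + 1 + 1))) fun x => (he (i + 1) _).2 ⟨x, rfl⟩)
      have h0 : (a.comp q).comp (d i) = 0 := by
        ext x
        have : q (d i x) = 0 := by
          rw [Subtype.ext_iff]
          exact (he i _).2 ⟨x, rfl⟩
        simp [this]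
      obtain ⟨b, hb⟩ := (hH Q _ _ hQ i (a.comp q)).1 h0
      refine ⟨b, ?_⟩
      ext x
      obtain ⟨y, rfl⟩ := s1.2.2 x
      exact LinearMap.congr_fun hb y
    | succ n ih =>
      intro i
      refine extZ_contra (ses (i + 1 + 1)) ?_ (extZ_projective _)
      have := ih (i - 1)
      rwa [sub_add_cancel] at this
  exact main n (-3)

lemma gp_res_ext (Q : Type u) [AddCommGroup Q] [Module R Q] (hQ : Module.Projective R Q) (m : ℕ) :
    ∀ (M : Type u) [AddCommGroup M] [Module R M],
    HasLeftResolutionLE R (fun N _ _ => GorensteinProjective R N) M m →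
    ∀ i, ExtZ R M Q (m + 1 + i) := by
  induction m with
  | zero =>
    intro M _ _ h i
    obtain ⟨G, _, _, hG, ⟨e⟩⟩ := res_zero h
    rw [show 0 + 1 + i = i + 1 by omega]
    exact extZ_equiv e (gp_ext hG Q hQ i)
  | succ m ih =>
    intro M _ _ h i
    obtain ⟨K, G, _, _, _, _, f, g, hs, hG, hK⟩ := res_succ h
    rw [show m + 1 + 1 + i = (m + 1 + i) + 1 by omega]
    exact extZ_contra hs (ih K hK i) (gp_ext hG Q hQ _)

lemma res_mono_class {𝒢 𝒢' : ∀ (N : Type u) [AddCommGroup N] [Module R N], Prop}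
    (h : ∀ (N : Type u) [AddCommGroup N] [Module R N], 𝒢 N → 𝒢' N)
    {M : Type u} [AddCommGroup M] [Module R M] {n : ℕ} (hM : HasLeftResolutionLE R 𝒢 M n) :
    HasLeftResolutionLE R 𝒢' M n := by
  obtain ⟨G, _, _, d, π, hG, hs⟩ := hM
  exact ⟨G, _, _, d, π, fun i => h _ (hG i), hs⟩

lemma gpDim_le_pDim (M : Type u) [AddCommGroup M] [Module R M] : gpDim R M ≤ pDim R M := by
  apply sInf_le_sInf
  apply Set.image_mono
  intro n hn
  exact res_mono_class (𝒢 := fun N _ _ => Module.Projective R N)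
    (𝒢' := fun N _ _ => GorensteinProjective R N) (fun N _ _ h => gp_of_proj h)
    (show HasLeftResolutionLE R (fun N _ _ => Module.Projective R N) M n from hn)

lemma pDim_le_gpDim (M : Type u) [AddCommGroup M] [Module R M] (h : pDim R M ≠ ⊤) :
    pDim R M ≤ gpDim R M := by
  obtain ⟨k, hk, -⟩ := dim_spec (d := pDim R M) rfl h
  refine le_sInf ?_
  rintro _ ⟨m, hm, rfl⟩
  have hk' := (res_proj_iff k M).1 hk
  refine pDim_le (pdLT_of_ext_proj (m := m + 1) ?_ k (pdLT_mono hk' (by omega)))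
  intro i hi Q _ _ hQ
  obtain ⟨j, rfl⟩ := Nat.exists_eq_add_of_le hi
  exact gp_res_ext Q hQ m M hm j

lemma flat_res_pd {m : ℕ} (H : ∀ (M : Type u) [AddCommGroup M] [Module R M] (k : ℕ),
    PdLT R M k → PdLT R M (m + 1)) (n : ℕ) : ∀ (M : Type u) [AddCommGroup M] [Module R M],
    HasLeftResolutionLE R (fun N _ _ => ModFlat R N) M n → PdLT R M (m + 1) := by
  induction n with
  | zero =>
    intro M _ _ h
    obtain ⟨G, _, _, hG, ⟨e⟩⟩ := res_zero h
    exact pdLT_equiv e (jensen H hG)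
  | succ n ih =>
    intro M _ _ h
    obtain ⟨K, G, _, _, _, _, f, g, hs, hG, hK⟩ := res_succ h
    exact H _ (m + 1 + 1) (pdLT_right hs (ih K hK) (pdLT_mono (jensen H hG) (by omega)))

lemma gldim_le_FPD (h : wgldim R ≠ ⊤) : gldim R ≤ FPD R := by
  by_cases hF : FPD R = ⊤
  · rw [hF]; exact le_top
  obtain ⟨m, hm⟩ := ENat.ne_top_iff_exists.1 hF
  have H : ∀ (M : Type u) [AddCommGroup M] [Module R M] (k : ℕ),
      PdLT R M k → PdLT R M (m + 1) := by
    intro M _ _ k hk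
    apply pdLT_of_pDim
    have hk' : pDim R M ≤ k := pDim_le (pdLT_mono hk (by omega))
    rw [hm]
    exact le_sSup ⟨M, _, _, ne_top_of_le_ne_top (by simp) hk', rfl⟩
  refine sSup_le ?_
  rintro _ ⟨M, _, _, rfl⟩
  have hfd : fDim R M ≠ ⊤ := ne_top_of_le_ne_top h (le_sSup ⟨M, _, _, rfl⟩)
  obtain ⟨n, hn, -⟩ := dim_spec (d := fDim R M) rfl hfd
  rw [← hm]
  exact pDim_le (flat_res_pd H n M hn)

end GP
/-- If `wgldim(R)` is finite, then `l.FPD(R) = l.Ggldim(R) = l.gldim(R)`. -/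
theorem FPD_eq_GPgldim_eq_gldim (R : Type u) [Ring R] (h : wgldim R ≠ ⊤) :
    FPD R = GPgldim R ∧ GPgldim R = gldim R := by
  have h1 : FPD R ≤ GPgldim R := by
    refine sSup_le ?_
    rintro _ ⟨M, _, _, hM, rfl⟩
    exact (pDim_le_gpDim M hM).trans (le_sSup ⟨M, _, _, rfl⟩)
  have h2 : GPgldim R ≤ gldim R := by
    refine sSup_le ?_
    rintro _ ⟨M, _, _, rfl⟩
    exact (gpDim_le_pDim M).trans (le_sSup ⟨M, _, _, rfl⟩)
  have h3 := gldim_le_FPD h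
  exact ⟨le_antisymm h1 (h2.trans h3), le_antisymm h2 (h3.trans h1)⟩
end
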